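/- There is a universal constant C > 0 such that for all p, q with q > 2 and p* ≥ 2, every a ∈ (0,1], all positive integers m, n, and every real m×n matrix A = (a_{ij}): E sup_{s ∈ B_{q*}^m ∩ a·B_∞^m} sup_{t ∈ B_p^n} Σ_{i≤m, j≤n} a_{ij} g_{ij} s_i t_j ≤ C·( √q·D2 + a^{(2−q*)/2}·D1·Log^{3/2} n ). -/

import Mathlib

open MeasureTheory ProbabilityTheory
open scoped ENNReal NNReal

noncomputable section

/-- The `ℓ_r` norm of a finite real vector, `r ∈ [1,∞]`. -/
def lpNorm (r : ℝ≥0∞) {ι : Type*} [Fintype ι] (x : ι → ℝ) : ℝ :=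
  if r = ⊤ then ⨆ i, |x i| else (∑ i, |x i| ^ r.toReal) ^ (1 / r.toReal)

/-- The operator norm `‖M‖_{p→q}` expressed via the conjugate exponent `q*`:
the supremum of the bilinear form over `s` in the unit ball of `ℓ_{q*}` and
`t` in the unit ball of `ℓ_p`. -/
def opNorm (p qstar : ℝ≥0∞) {ι κ : Type*} [Fintype ι] [Fintype κ]
    (M : ι → κ → ℝ) : ℝ :=
  sSup { x : ℝ | ∃ s : ι → ℝ, ∃ t : κ → ℝ,
    lpNorm qstar s ≤ 1 ∧ lpNorm p t ≤ 1 ∧ x = ∑ i, ∑ j, M i j * s i * t j }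

/-- The standard Gaussian product measure on `ι → ℝ` (iid `N(0,1)` coordinates). -/
def stdGaussian (ι : Type*) [Fintype ι] : Measure (ι → ℝ) :=
  Measure.pi fun _ => gaussianReal 0 1

/-- `Log x = max 1 (ln x)`; in particular `Log 0 = 1`. -/
def Log (x : ℝ) : ℝ := max 1 (Real.log x)

/-- `E‖G_A‖_{p→q}` for the Gaussian matrix `G_A = (a_{ij} g_{ij})`. -/
def EopNorm (p qstar : ℝ≥0∞) {m n : ℕ} (A : Fin m → Fin n → ℝ) : ℝ :=
  ∫ g : Fin m × Fin n → ℝ,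
    opNorm p qstar (fun i j => A i j * g (i, j)) ∂ stdGaussian (Fin m × Fin n)

/-- `D1 = max_i ‖(a_{ij})_j‖_{p*}`. -/
def D1 (pstar : ℝ≥0∞) {m n : ℕ} (A : Fin m → Fin n → ℝ) : ℝ :=
  ⨆ i, lpNorm pstar (fun j => A i j)

/-- `D2 = max_j ‖(a_{ij})_i‖_q`. -/
def D2 (q : ℝ≥0∞) {m n : ℕ} (A : Fin m → Fin n → ℝ) : ℝ :=
  ⨆ j, lpNorm q (fun i => A i j)

/-- `max_{i,j} |a_{ij}|`. -/
def maxEntry {m n : ℕ} (A : Fin m → Fin n → ℝ) : ℝ :=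
  ⨆ ij : Fin m × Fin n, |A ij.1 ij.2|

/-- `max_{k ≥ 0} inf_{I ⊂ [m]×[n], |I| = k} √(Log k) · max_{(i,j) ∉ I} |a_{ij}|`
(for `k > mn` the term vanishes, so `k` ranges over `0,…,mn`). -/
def Dinf {m n : ℕ} (A : Fin m → Fin n → ℝ) : ℝ :=
  ⨆ k : Fin (m * n + 1),
    ⨅ I : { I : Finset (Fin m × Fin n) // I.card = k.1 },
      Real.sqrt (Log (k.1 : ℝ)) *
        ⨆ ij : { ij : Fin m × Fin n // ij ∉ I.1 }, |A ij.1.1 ij.1.2|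

/-- `E max_{i,j} |a_{ij} g_{ij}|`. -/
def EmaxGauss {m n : ℕ} (A : Fin m → Fin n → ℝ) : ℝ :=
  ∫ g : Fin m × Fin n → ℝ,
    (⨆ ij : Fin m × Fin n, |A ij.1 ij.2 * g ij|) ∂ stdGaussian (Fin m × Fin n)

instance isProbabilityMeasure_stdGaussian {ι : Type*} [Fintype ι] :
    IsProbabilityMeasure (_root_.stdGaussian ι) := by
  unfold _root_.stdGaussian; infer_instance

lemma integrable_exp_mul_abs_gaussianReal (c : ℝ) :
    Integrable (fun x : ℝ => Real.exp (c * |x|)) (gaussianReal 0 1) :=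
  integrable_exp_mul_abs (X := fun x : ℝ => x) (integrable_exp_mul_gaussianReal c)
    (integrable_exp_mul_gaussianReal (-c))

lemma integrable_gaussianReal_of_le {f : ℝ → ℝ} (hf : Continuous f) {B c : ℝ}
    (hb : ∀ x, |f x| ≤ B * Real.exp (c * |x|)) : Integrable f (gaussianReal 0 1) :=
  ((integrable_exp_mul_abs_gaussianReal c).const_mul B).mono' hf.aestronglyMeasurable
    (Filter.Eventually.of_forall hb)

lemma abs_le_exp_abs (x : ℝ) : |x| ≤ Real.exp |x| := by
  linarith [Real.add_one_le_exp |x|]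

lemma hasDerivAt_gaussianPDFReal (x : ℝ) :
    HasDerivAt (gaussianPDFReal 0 1) (-x * gaussianPDFReal 0 1 x) x := by
  rw [gaussianPDFReal_def]
  have h : HasDerivAt (fun y : ℝ => -(y - 0) ^ 2 / (2 * ((1 : ℝ≥0) : ℝ))) (-x) x := by
    have := (((hasDerivAt_id x).sub_const 0).pow 2).neg.div_const (2 * ((1 : ℝ≥0) : ℝ))
    convert! this using 1
    simp; ring
  convert! (h.exp.const_mul _) using 1
  ring

/-- Gaussian integration by parts on the line. -/
lemma integral_mul_gaussianReal {f f' : ℝ → ℝ} (hf : ∀ x, HasDerivAt f (f' x) x)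
    (hf' : Continuous f') {B c : ℝ} (hb : ∀ x, |f x| ≤ B * Real.exp (c * |x|))
    (hb' : ∀ x, |f' x| ≤ B * Real.exp (c * |x|)) :
    ∫ x, x * f x ∂(gaussianReal 0 1) = ∫ x, f' x ∂(gaussianReal 0 1) := by
  have hfc : Continuous f := continuous_iff_continuousAt.2 fun x => (hf x).continuousAt
  have key : ∀ {h : ℝ → ℝ}, Integrable h (gaussianReal 0 1) →
      Integrable (fun x => h x * gaussianPDFReal 0 1 x) := by
    intro h hh
    rw [gaussianReal_of_var_ne_zero _ one_ne_zero] at hh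
    rw [integrable_withDensity_iff_integrable_smul' (by fun_prop)
      (Filter.Eventually.of_forall fun x => gaussianPDF_lt_top)] at hh
    simpa [toReal_gaussianPDF, mul_comm] using hh
  have i1 : Integrable f (gaussianReal 0 1) := integrable_gaussianReal_of_le hfc hb
  have i2 : Integrable f' (gaussianReal 0 1) := integrable_gaussianReal_of_le hf' hb'
  have i3 : Integrable (fun x => x * f x) (gaussianReal 0 1) := by
    refine integrable_gaussianReal_of_le (by fun_prop) (B := B) (c := c + 1) fun x => ?_
    rw [abs_mul, add_mul, Real.exp_add, one_mul]
    have := mul_le_mul (abs_le_exp_abs x) (hb x) (abs_nonneg _) (Real.exp_pos _).le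
    linarith
  have := integral_mul_deriv_eq_deriv_mul_of_integrable (u := f) (u' := f')
    (v := gaussianPDFReal 0 1) (v' := fun x => -x * gaussianPDFReal 0 1 x)
    (fun x _ => hf x) (fun x _ => hasDerivAt_gaussianPDFReal x)
    (by
      have := (key i3).neg
      refine this.congr (Filter.Eventually.of_forall fun x => ?_)
      simp only [Pi.neg_apply, Pi.mul_apply]; ring)
    (key i2) (key i1)
  rw [integral_gaussianReal_eq_integral_smul one_ne_zero,
    integral_gaussianReal_eq_integral_smul one_ne_zero]
  simp only [smul_eq_mul]
  calc ∫ x, gaussianPDFReal 0 1 x * (x * f x)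
      = -∫ x, f x * (-x * gaussianPDFReal 0 1 x) := by
        rw [← integral_neg]; congr 1; ext x; ring
    _ = ∫ x, gaussianPDFReal 0 1 x * f' x := by
        rw [this, neg_neg]; congr 1; ext x; ring

section Pi

variable {E : Type*} [Fintype E]

lemma integrable_exp_mul_sum_abs (c : ℝ) :
    Integrable (fun g : E → ℝ => Real.exp (c * ∑ e, |g e|)) (_root_.stdGaussian E) := by
  have := Integrable.fintype_prod (μ := fun _ : E => gaussianReal 0 1)
    (f := fun (_ : E) (x : ℝ) => Real.exp (c * |x|))
    (fun _ => integrable_exp_mul_abs_gaussianReal c)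
  simpa [_root_.stdGaussian, Finset.mul_sum, Real.exp_sum] using this

lemma integrable_stdGaussian_of_le {f : (E → ℝ) → ℝ} (hf : Continuous f) {B c : ℝ}
    (hb : ∀ g, |f g| ≤ B * Real.exp (c * ∑ e, |g e|)) :
    Integrable f (_root_.stdGaussian E) :=
  ((integrable_exp_mul_sum_abs c).const_mul B).mono' hf.aestronglyMeasurable
    (Filter.Eventually.of_forall hb)

lemma measurePreserving_update [DecidableEq E] (e : E) :
    MeasurePreserving (fun z : (E → ℝ) × ℝ => Function.update z.1 e z.2)
      ((_root_.stdGaussian E).prod (gaussianReal 0 1)) (_root_.stdGaussian E) := by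
  have hm : Measurable (fun z : (E → ℝ) × ℝ => Function.update z.1 e z.2) := by
    rw [measurable_pi_iff]
    intro i
    by_cases h : i = e
    · subst h; simpa using measurable_snd
    · simp only [Function.update_of_ne h]; fun_prop
  refine ⟨hm, ?_⟩
  symm
  refine Measure.pi_eq fun s hs => ?_
  rw [Measure.map_apply hm (MeasurableSet.univ_pi hs)]
  have : (fun z : (E → ℝ) × ℝ => Function.update z.1 e z.2) ⁻¹' (Set.univ.pi s)
      = (Set.univ.pi (Function.update s e Set.univ)) ×ˢ s e := by
    ext ⟨x, y⟩
    simp only [Set.mem_preimage, Set.mem_pi, Set.mem_univ, true_imp_iff, Set.mem_prod]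
    constructor
    · intro h
      refine ⟨fun i => ?_, by simpa using h e⟩
      by_cases hi : i = e
      · subst hi; simp
      · simpa [Function.update_of_ne hi] using h i
    · rintro ⟨h, hy⟩ i
      by_cases hi : i = e
      · subst hi; simpa using hy
      · simpa [Function.update_of_ne hi] using h i
  rw [this, Measure.prod_prod, _root_.stdGaussian, Measure.pi_pi,
    ← Finset.prod_erase_mul _ _ (Finset.mem_univ e),
    ← Finset.prod_erase_mul (a := e) Finset.univ (fun i => gaussianReal 0 1 (s i))
      (Finset.mem_univ e)]
  congr 1
  rw [Function.update_self, measure_univ, mul_one]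
  refine Finset.prod_congr rfl fun i hi => ?_
  rw [Function.update_of_ne (Finset.ne_of_mem_erase hi)]

lemma abs_le_sum_abs (g : E → ℝ) (e : E) : |g e| ≤ ∑ i, |g i| :=
  Finset.single_le_sum (f := fun i => |g i|) (fun _ _ => abs_nonneg _) (Finset.mem_univ e)

lemma sum_abs_update_le [DecidableEq E] (g : E → ℝ) (e : E) (y : ℝ) :
    ∑ i, |Function.update g e y i| ≤ ∑ i, |g i| + |y| := by
  rw [← Finset.sum_erase_add _ _ (Finset.mem_univ e), Function.update_self]
  gcongr
  rw [← Finset.sum_erase_add Finset.univ (fun i => |g i|) (Finset.mem_univ e)]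
  refine le_add_of_le_of_nonneg (Finset.sum_le_sum fun i hi => ?_) (abs_nonneg _)
  rw [Function.update_of_ne (Finset.ne_of_mem_erase hi)]

/-- Gaussian integration by parts for the standard Gaussian product measure. -/
lemma integral_mul_stdGaussian [DecidableEq E] (e : E) {f f' : (E → ℝ) → ℝ}
    (hf : ∀ g, HasDerivAt (fun y => f (Function.update g e y)) (f' g) (g e))
    (hfc : Continuous f) (hf' : Continuous f') {B c : ℝ} (hB : 0 ≤ B) (hc : 0 ≤ c)
    (hb : ∀ g, |f g| ≤ B * Real.exp (c * ∑ i, |g i|))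
    (hb' : ∀ g, |f' g| ≤ B * Real.exp (c * ∑ i, |g i|)) :
    ∫ g, g e * f g ∂(_root_.stdGaussian E) = ∫ g, f' g ∂(_root_.stdGaussian E) := by
  have i1 : Integrable (fun g : E → ℝ => g e * f g) (_root_.stdGaussian E) := by
    refine integrable_stdGaussian_of_le (by fun_prop) (B := B) (c := c + 1) fun g => ?_
    rw [abs_mul, add_mul, Real.exp_add, one_mul]
    have h1 : |g e| ≤ Real.exp (∑ i, |g i|) := by
      have := abs_le_sum_abs g e
      linarith [Real.add_one_le_exp (∑ i, |g i|)]
    have := mul_le_mul h1 (hb g) (abs_nonneg _) (Real.exp_pos _).le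
    linarith
  have i2 : Integrable f' (_root_.stdGaussian E) := integrable_stdGaussian_of_le hf' hb'
  have mp := measurePreserving_update e
  have hupd : ∀ g : E → ℝ, Continuous fun y : ℝ => Function.update g e y := fun g =>
    continuous_const.update e continuous_id
  have change : ∀ {h : (E → ℝ) → ℝ}, Integrable h (_root_.stdGaussian E) →
      ∫ g, h g ∂(_root_.stdGaussian E)
        = ∫ g, ∫ y, h (Function.update g e y) ∂(gaussianReal 0 1) ∂(_root_.stdGaussian E) := by
    intro h hh
    rw [← mp.map_eq] at hh
    have hh' := hh.comp_measurable mp.measurable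
    conv_lhs => rw [← mp.map_eq]
    rw [integral_map mp.measurable.aemeasurable hh.aestronglyMeasurable]
    exact integral_prod _ hh'
  rw [change i1, change i2]
  congr 1
  ext g
  simp only [Function.update_self]
  have bd : ∀ {h : (E → ℝ) → ℝ}, (∀ g, |h g| ≤ B * Real.exp (c * ∑ i, |g i|)) → ∀ y,
      |h (Function.update g e y)| ≤ (B * Real.exp (c * ∑ i, |g i|)) * Real.exp (c * |y|) := by
    intro h hh y
    refine (hh _).trans ?_
    rw [mul_assoc, ← Real.exp_add, ← mul_add]
    gcongr
    exact sum_abs_update_le g e y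
  refine integral_mul_gaussianReal (f := fun y => f (Function.update g e y))
    (fun y => ?_) (hf'.comp (hupd g)) (bd hb) (bd hb')
  have := hf (Function.update g e y)
  simpa using this

end Pi

/-- A `C²` function on `ι → ℝ` with gradient `D` and Hessian `H`, all of at most exponential
growth. -/
structure IsSmoothExp {ι : Type*} [Fintype ι] (Φ : (ι → ℝ) → ℝ) (D : ι → (ι → ℝ) → ℝ)
    (H : ι → ι → (ι → ℝ) → ℝ) (B c : ℝ) : Prop where
  nonneg_B : 0 ≤ B
  nonneg_c : 0 ≤ c
  hasFDerivAt : ∀ z, HasFDerivAt Φ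
    (∑ k, D k z • (ContinuousLinearMap.proj k : (ι → ℝ) →L[ℝ] ℝ)) z
  hasFDerivAt_grad : ∀ k z, HasFDerivAt (D k)
    (∑ l, H k l z • (ContinuousLinearMap.proj l : (ι → ℝ) →L[ℝ] ℝ)) z
  continuous_hess : ∀ k l, Continuous (H k l)
  bound : ∀ z, |Φ z| ≤ B * Real.exp (c * ∑ k, |z k|)
  bound_grad : ∀ k z, |D k z| ≤ B * Real.exp (c * ∑ k, |z k|)
  bound_hess : ∀ k l z, |H k l z| ≤ B * Real.exp (c * ∑ k, |z k|)

/-- The linear images `∑ e, u k e * g e` of a point `g`. -/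
def linImage {ι E : Type*} [Fintype E] (u : ι → E → ℝ) (g : E → ℝ) (k : ι) : ℝ :=
  ∑ e, u k e * g e

section

variable {ι E : Type*} [Fintype ι] [Fintype E]

omit [Fintype ι] in
lemma continuous_linImage (u : ι → E → ℝ) : Continuous (linImage u) := by
  unfold linImage; fun_prop

omit [Fintype ι] in
lemma abs_linImage_le {u : ι → E → ℝ} {R : ℝ} (hu : ∀ k e, |u k e| ≤ R) (g : E → ℝ) (k : ι) :
    |linImage u g k| ≤ R * ∑ e, |g e| := by
  unfold linImage
  rw [Finset.mul_sum]
  refine (Finset.abs_sum_le_sum_abs _ _).trans (Finset.sum_le_sum fun e _ => ?_)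
  rw [abs_mul]
  exact mul_le_mul_of_nonneg_right (hu k e) (abs_nonneg _)

lemma exp_sum_abs_linImage_le {u : ι → E → ℝ} {R c : ℝ} (hc : 0 ≤ c)
    (hu : ∀ k e, |u k e| ≤ R) (g : E → ℝ) :
    Real.exp (c * ∑ k, |linImage u g k|)
      ≤ Real.exp (c * (Fintype.card ι * R) * ∑ e, |g e|) := by
  refine Real.exp_le_exp.2 ?_
  rw [mul_assoc]
  refine mul_le_mul_of_nonneg_left ?_ hc
  refine (Finset.sum_le_sum fun k _ => abs_linImage_le hu g k).trans (le_of_eq ?_)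
  simp [mul_assoc]

lemma exists_abs_le (u : ι → E → ℝ) : ∃ R, 0 ≤ R ∧ ∀ k e, |u k e| ≤ R :=
  ⟨∑ k, ∑ e, |u k e|, by positivity, fun k e =>
    (Finset.single_le_sum (f := fun e => |u k e|) (fun _ _ => abs_nonneg _)
      (Finset.mem_univ e)).trans
    (Finset.single_le_sum (f := fun k => ∑ e, |u k e|)
      (fun _ _ => Finset.sum_nonneg fun _ _ => abs_nonneg _) (Finset.mem_univ k))⟩

lemma integrable_comp_linImage {f : (ι → ℝ) → ℝ} (hf : Continuous f) {B c : ℝ} (hB : 0 ≤ B)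
    (hc : 0 ≤ c) (hb : ∀ z, |f z| ≤ B * Real.exp (c * ∑ k, |z k|)) (u : ι → E → ℝ) :
    Integrable (fun g => f (linImage u g)) (_root_.stdGaussian E) := by
  obtain ⟨R, hR, hu⟩ := exists_abs_le u
  refine integrable_stdGaussian_of_le (hf.comp (continuous_linImage u)) (B := B)
    (c := c * (Fintype.card ι * R)) fun g => (hb _).trans ?_
  exact mul_le_mul_of_nonneg_left (exp_sum_abs_linImage_le hc hu g) hB

namespace IsSmoothExp

variable {Φ : (ι → ℝ) → ℝ} {D : ι → (ι → ℝ) → ℝ} {H : ι → ι → (ι → ℝ) → ℝ} {B c : ℝ}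

lemma continuous (h : IsSmoothExp Φ D H B c) : Continuous Φ :=
  continuous_iff_continuousAt.2 fun z => (h.hasFDerivAt z).continuousAt

lemma continuous_grad (h : IsSmoothExp Φ D H B c) (k : ι) : Continuous (D k) :=
  continuous_iff_continuousAt.2 fun z => (h.hasFDerivAt_grad k z).continuousAt

lemma integral_mul_grad (h : IsSmoothExp Φ D H B c) (u : ι → E → ℝ) (k : ι) (e : E) :
    ∫ g, g e * D k (linImage u g) ∂(_root_.stdGaussian E)
      = ∑ l, u l e * ∫ g, H k l (linImage u g) ∂(_root_.stdGaussian E) := by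
  classical
  obtain ⟨R, hR, hu⟩ := exists_abs_le u
  have hexp := fun g => exp_sum_abs_linImage_le h.nonneg_c hu g
  have hint : ∀ l, Integrable (fun g => H k l (linImage u g)) (_root_.stdGaussian E) := fun l =>
    integrable_comp_linImage (h.continuous_hess k l) h.nonneg_B h.nonneg_c (h.bound_hess k l) u
  simp_rw [← integral_const_mul]
  rw [← integral_finsetSum _ fun l _ => (hint l).const_mul _]
  have hB := h.nonneg_B
  have hc := h.nonneg_c
  set B' := B * (1 + Fintype.card ι * R) with hB'
  have hBB' : B ≤ B' := by
    rw [hB']; nlinarith [mul_nonneg hB (mul_nonneg (Nat.cast_nonneg (α := ℝ) (Fintype.card ι)) hR)]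
  refine integral_mul_stdGaussian e (f := fun g => D k (linImage u g)) (B := B')
    (c := c * (Fintype.card ι * R)) (fun g => ?_)
    ((h.continuous_grad k).comp (continuous_linImage u))
    (continuous_finsetSum _ fun l _ => continuous_const.mul
      ((h.continuous_hess k l).comp (continuous_linImage u))) (by positivity) (by positivity)
    (fun g => ?_) (fun g => ?_)
  · have h1 : HasDerivAt (fun y => linImage u (Function.update g e y)) (fun l => u l e) (g e) := by
      rw [hasDerivAt_pi]
      intro l
      unfold linImage
      have : HasDerivAt (fun y => ∑ i, u l i * Function.update g e y i)
          (∑ i, u l i * (Pi.single e 1 : E → ℝ) i) (g e) := by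
        refine HasDerivAt.fun_sum fun i _ => HasDerivAt.const_mul _ ?_
        exact hasDerivAt_pi.1 (hasDerivAt_update g e (g e)) i
      simpa [Pi.single_apply] using this
    have h2 := h.hasFDerivAt_grad k (linImage u (Function.update g e (g e)))
    have h3 := h2.comp_hasDerivAt (g e) h1
    simp only [Function.update_eq_self] at h3
    convert! h3 using 1
    simp [mul_comm]
  · refine (h.bound_grad k _).trans ?_
    have := hexp g
    gcongr
  · refine (Finset.abs_sum_le_sum_abs _ _).trans ?_
    calc ∑ l, |u l e * H k l (linImage u g)|
        ≤ ∑ l : ι, R * (B * Real.exp (c * (Fintype.card ι * R) * ∑ e, |g e|)) := by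
          refine Finset.sum_le_sum fun l _ => ?_
          rw [abs_mul]
          refine mul_le_mul (hu l e) ((h.bound_hess k l _).trans ?_) (abs_nonneg _) hR
          have := hexp g
          gcongr
      _ = (B * (Fintype.card ι * R)) * Real.exp (c * (Fintype.card ι * R) * ∑ e, |g e|) := by
          simp; ring
      _ ≤ _ := by
          gcongr
          rw [hB']; linarith

/-- Differentiation of a Gaussian expectation along a path of linear maps. -/
lemma hasDerivAt_integral (h : IsSmoothExp Φ D H B c) {w w' : ℝ → ι → E → ℝ} {R : ℝ}
    (hw : ∀ θ k e, HasDerivAt (fun t => w t k e) (w' θ k e) θ)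
    (hR : 0 ≤ R) (hwR : ∀ θ k e, |w θ k e| ≤ R) (hwR' : ∀ θ k e, |w' θ k e| ≤ R) (θ : ℝ) :
    HasDerivAt (fun t => ∫ g, Φ (linImage (w t) g) ∂(_root_.stdGaussian E))
      (∑ k, ∑ l, (∑ e, w' θ k e * w θ l e) *
        ∫ g, H k l (linImage (w θ) g) ∂(_root_.stdGaussian E)) θ := by
  have hB := h.nonneg_B
  have hc := h.nonneg_c
  set c' := c * (Fintype.card ι * R) with hc'
  have hbD : ∀ t g k, |D k (linImage (w t) g)| ≤ B * Real.exp (c' * ∑ e, |g e|) := fun t g k =>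
    (h.bound_grad k _).trans
      (mul_le_mul_of_nonneg_left (exp_sum_abs_linImage_le hc (hwR t) g) hB)
  have key := hasDerivAt_integral_of_dominated_loc_of_deriv_le (μ := _root_.stdGaussian E)
    (F := fun t g => Φ (linImage (w t) g))
    (F' := fun t g => ∑ k, D k (linImage (w t) g) * linImage (w' t) g k)
    (s := Set.univ) (x₀ := θ)
    (bound := fun g => (Fintype.card ι * (B * R)) * Real.exp ((c' + 1) * ∑ e, |g e|))
    Filter.univ_mem
    (Filter.Eventually.of_forall fun t =>
      (h.continuous.comp (continuous_linImage (w t))).aestronglyMeasurable)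
    (integrable_comp_linImage h.continuous hB hc h.bound (w θ))
    (by
      refine Continuous.aestronglyMeasurable ?_
      refine continuous_finsetSum _ fun k _ => ?_
      exact ((h.continuous_grad k).comp (continuous_linImage (w θ))).mul
        ((continuous_apply k).comp (continuous_linImage (w' θ))))
    (Filter.Eventually.of_forall fun g t _ => by
      refine (Finset.abs_sum_le_sum_abs _ _).trans ?_
      calc ∑ k, |D k (linImage (w t) g) * linImage (w' t) g k|
          ≤ ∑ k : ι, (B * Real.exp (c' * ∑ e, |g e|)) * (R * Real.exp (∑ e, |g e|)) := by
            refine Finset.sum_le_sum fun k _ => ?_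
            rw [abs_mul]
            refine mul_le_mul (hbD t g k) ((abs_linImage_le (hwR' t) g k).trans ?_)
              (abs_nonneg _) (by positivity)
            refine mul_le_mul_of_nonneg_left ?_ hR
            linarith [Real.add_one_le_exp (∑ e, |g e|)]
        _ = _ := by
            rw [add_mul, Real.exp_add, one_mul]; simp; ring)
    ((integrable_exp_mul_sum_abs (c' + 1)).const_mul _)
    (Filter.Eventually.of_forall fun g t _ => by
      have h1 : HasDerivAt (fun s => linImage (w s) g) (linImage (w' t) g) t := by
        rw [hasDerivAt_pi]
        intro k
        unfold linImage
        exact HasDerivAt.fun_sum fun e _ => (hw t k e).mul_const _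
      have h3 := (h.hasFDerivAt (linImage (w t) g)).comp_hasDerivAt t h1
      convert! h3 using 1
      simp)
  have hint : ∀ k e, Integrable (fun g : E → ℝ => g e * D k (linImage (w θ) g))
      (_root_.stdGaussian E) := by
    intro k e
    refine integrable_stdGaussian_of_le
      ((continuous_apply e).mul ((h.continuous_grad k).comp (continuous_linImage (w θ))))
      (B := B) (c := c' + 1) fun g => ?_
    rw [abs_mul, add_mul, Real.exp_add, one_mul]
    have h1 : |g e| ≤ Real.exp (∑ i, |g i|) := by
      have := abs_le_sum_abs g e
      linarith [Real.add_one_le_exp (∑ i, |g i|)]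
    have := mul_le_mul h1 (hbD θ g k) (abs_nonneg _) (Real.exp_pos _).le
    linarith
  have e1 : ∫ g, ∑ k, D k (linImage (w θ) g) * linImage (w' θ) g k ∂(_root_.stdGaussian E)
      = ∑ k, ∑ l, (∑ e, w' θ k e * w θ l e) *
        ∫ g, H k l (linImage (w θ) g) ∂(_root_.stdGaussian E) := by
    have : ∀ g : E → ℝ, ∑ k, D k (linImage (w θ) g) * linImage (w' θ) g k
        = ∑ k, ∑ e, w' θ k e * (g e * D k (linImage (w θ) g)) := by
      intro g
      refine Finset.sum_congr rfl fun k _ => ?_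
      rw [linImage, Finset.mul_sum]
      exact Finset.sum_congr rfl fun e _ => by ring
    simp_rw [this]
    rw [integral_finsetSum _ fun k _ => integrable_finsetSum _ fun e _ => (hint k e).const_mul _]
    refine Finset.sum_congr rfl fun k _ => ?_
    rw [integral_finsetSum _ fun e _ => (hint k e).const_mul _]
    simp_rw [integral_const_mul, h.integral_mul_grad, Finset.mul_sum, Finset.sum_mul]
    rw [Finset.sum_comm]
    exact Finset.sum_congr rfl fun l _ => Finset.sum_congr rfl fun e _ => by ring
  rw [← e1]
  exact key.2

/-- Rotation path between two linear images with mutually orthogonal coefficients. -/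
lemma hasDerivAt_integral_rotation (h : IsSmoothExp Φ D H B c) (u v : ι → E → ℝ)
    (huv : ∀ k l, ∑ e, u k e * v l e = 0) (θ : ℝ) :
    HasDerivAt (fun t => ∫ g, Φ (linImage (fun k e => Real.cos t * u k e + Real.sin t * v k e) g)
        ∂(_root_.stdGaussian E))
      (Real.sin θ * Real.cos θ * ∑ k, ∑ l, (∑ e, v k e * v l e - ∑ e, u k e * u l e) *
        ∫ g, H k l (linImage (fun k e => Real.cos θ * u k e + Real.sin θ * v k e) g)
          ∂(_root_.stdGaussian E)) θ := by
  obtain ⟨R, hR, hu⟩ := exists_abs_le u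
  obtain ⟨S, hS, hv⟩ := exists_abs_le v
  have bd : ∀ a b x y : ℝ, |a| ≤ 1 → |b| ≤ 1 → |x| ≤ R → |y| ≤ S → |a * x + b * y| ≤ R + S := by
    intro a b x y ha hb hx hy
    refine (abs_add_le _ _).trans ?_
    rw [abs_mul, abs_mul]
    have h1 := mul_le_mul ha hx (abs_nonneg _) zero_le_one
    have h2 := mul_le_mul hb hy (abs_nonneg _) zero_le_one
    linarith
  have := h.hasDerivAt_integral (E := E)
    (w := fun t k e => Real.cos t * u k e + Real.sin t * v k e)
    (w' := fun t k e => (-Real.sin t) * u k e + Real.cos t * v k e) (R := R + S)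
    (fun t k e => ((Real.hasDerivAt_cos t).mul_const _).add ((Real.hasDerivAt_sin t).mul_const _))
    (by positivity)
    (fun t k e => bd _ _ _ _ (Real.abs_cos_le_one t) (Real.abs_sin_le_one t) (hu k e) (hv k e))
    (fun t k e => bd _ _ _ _ (by rw [abs_neg]; exact Real.abs_sin_le_one t)
      (Real.abs_cos_le_one t) (hu k e) (hv k e)) θ
  convert! this using 1
  rw [Finset.mul_sum]
  refine Finset.sum_congr rfl fun k _ => ?_
  rw [Finset.mul_sum]
  refine Finset.sum_congr rfl fun l _ => ?_
  rw [← mul_assoc]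
  congr 1
  have h1 := huv k l
  have h2 := huv l k
  have : ∑ e, (-Real.sin θ * u k e + Real.cos θ * v k e) *
      (Real.cos θ * u l e + Real.sin θ * v l e)
      = Real.sin θ * Real.cos θ * (∑ e, v k e * v l e - ∑ e, u k e * u l e)
        - Real.sin θ ^ 2 * ∑ e, u k e * v l e + Real.cos θ ^ 2 * ∑ e, u l e * v k e := by
    simp_rw [← Finset.sum_sub_distrib, Finset.mul_sum, ← Finset.sum_sub_distrib,
      ← Finset.sum_add_distrib]
    exact Finset.sum_congr rfl fun e _ => by ring
  rw [this, h1, h2]; ring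

end IsSmoothExp
end

/-- The free energy `β⁻¹ log ∑ exp (β z_k)`, a smooth approximation of the maximum. -/
def softMax {ι : Type*} [Fintype ι] (β : ℝ) (z : ι → ℝ) : ℝ :=
  β⁻¹ * Real.log (∑ k, Real.exp (β * z k))

/-- The Gibbs weights, i.e. the gradient of `softMax β`. -/
def gibbs {ι : Type*} [Fintype ι] (β : ℝ) (k : ι) (z : ι → ℝ) : ℝ :=
  Real.exp (β * (z k - softMax β z))

/-- The Hessian of `softMax β`. -/
def gibbsHess {ι : Type*} [Fintype ι] [DecidableEq ι] (β : ℝ) (k l : ι) (z : ι → ℝ) : ℝ :=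
  β * gibbs β k z * ((if k = l then 1 else 0) - gibbs β l z)

section

variable {ι : Type*} [Fintype ι] [Nonempty ι]

lemma sum_exp_pos (β : ℝ) (z : ι → ℝ) : 0 < ∑ k, Real.exp (β * z k) :=
  Finset.sum_pos (fun _ _ => Real.exp_pos _) Finset.univ_nonempty

lemma gibbs_eq {β : ℝ} (hβ : 0 < β) (k : ι) (z : ι → ℝ) :
    gibbs β k z = Real.exp (β * z k) / ∑ l, Real.exp (β * z l) := by
  rw [gibbs, softMax, mul_sub, mul_inv_cancel_left₀ hβ.ne', Real.exp_sub,
    Real.exp_log (sum_exp_pos β z)]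

omit [Nonempty ι] in
lemma gibbs_pos (β : ℝ) (k : ι) (z : ι → ℝ) : 0 < gibbs β k z := Real.exp_pos _

lemma sum_gibbs {β : ℝ} (hβ : 0 < β) (z : ι → ℝ) : ∑ k, gibbs β k z = 1 := by
  simp_rw [gibbs_eq hβ, ← Finset.sum_div]
  exact div_self (sum_exp_pos β z).ne'

lemma gibbs_le_one {β : ℝ} (hβ : 0 < β) (k : ι) (z : ι → ℝ) : gibbs β k z ≤ 1 := by
  rw [← sum_gibbs hβ z]
  exact Finset.single_le_sum (fun l _ => (gibbs_pos β l z).le) (Finset.mem_univ k)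

lemma le_softMax {β : ℝ} (hβ : 0 < β) (z : ι → ℝ) (k : ι) : z k ≤ softMax β z := by
  have := gibbs_le_one hβ k z
  rw [gibbs, Real.exp_le_one_iff] at this
  nlinarith

lemma softMax_le {β : ℝ} (hβ : 0 < β) {z : ι → ℝ} {M : ℝ} (hM : ∀ k, z k ≤ M) :
    softMax β z ≤ M + Real.log (Fintype.card ι) / β := by
  have hN : (0 : ℝ) < Fintype.card ι := by exact_mod_cast Fintype.card_pos
  have : Real.log (∑ k, Real.exp (β * z k)) ≤ Real.log (Fintype.card ι) + β * M := by
    rw [← Real.log_exp (β * M), ← Real.log_mul hN.ne' (Real.exp_pos _).ne']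
    refine Real.log_le_log (sum_exp_pos β z) ?_
    calc ∑ k, Real.exp (β * z k) ≤ ∑ _k : ι, Real.exp (β * M) := by
          refine Finset.sum_le_sum fun k _ => Real.exp_le_exp.2 ?_
          exact mul_le_mul_of_nonneg_left (hM k) hβ.le
      _ = _ := by simp
  rw [softMax, inv_mul_le_iff₀ hβ]
  refine this.trans (le_of_eq ?_)
  field_simp; ring

lemma log_card_nonneg : 0 ≤ Real.log (Fintype.card ι) :=
  Real.log_nonneg (by exact_mod_cast Fintype.card_pos)

lemma softMax_le_sum {β : ℝ} (hβ : 0 < β) (z : ι → ℝ) :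
    softMax β z ≤ ∑ k, |z k| + Real.log (Fintype.card ι) / β :=
  softMax_le hβ fun k => (le_abs_self _).trans (abs_le_sum_abs z k)

lemma neg_sum_le_softMax {β : ℝ} (hβ : 0 < β) (z : ι → ℝ) : -∑ k, |z k| ≤ softMax β z := by
  obtain ⟨k⟩ := ‹Nonempty ι›
  have := le_softMax hβ z k
  have h2 := abs_le_sum_abs z k
  linarith [neg_abs_le (z k)]

lemma hasFDerivAt_softMax {β : ℝ} (hβ : 0 < β) (z : ι → ℝ) :
    HasFDerivAt (softMax β)
      (∑ k, gibbs β k z • (ContinuousLinearMap.proj k : (ι → ℝ) →L[ℝ] ℝ)) z := by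
  have h1 : ∀ k, HasFDerivAt (fun y : ι → ℝ => Real.exp (β * y k))
      (Real.exp (β * z k) • β • (ContinuousLinearMap.proj k : (ι → ℝ) →L[ℝ] ℝ)) z := fun k =>
    ((hasFDerivAt_apply k z).const_mul β).exp
  have h2 := ((HasFDerivAt.fun_sum fun k (_ : k ∈ Finset.univ) => h1 k).log
    (sum_exp_pos β z).ne').const_mul β⁻¹
  convert! h2 using 1
  ext y
  simp only [gibbs_eq hβ]
  simp [Finset.mul_sum]
  refine Finset.sum_congr rfl fun k _ => ?_
  field_simp

lemma hasFDerivAt_gibbs [DecidableEq ι] {β : ℝ} (hβ : 0 < β) (k : ι) (z : ι → ℝ) :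
    HasFDerivAt (gibbs β k)
      (∑ l, gibbsHess β k l z • (ContinuousLinearMap.proj l : (ι → ℝ) →L[ℝ] ℝ)) z := by
  have h := (((hasFDerivAt_apply k z).sub (hasFDerivAt_softMax hβ z)).const_mul β).exp
  convert! h using 1
  ext y
  simp only [gibbsHess]
  simp [Finset.mul_sum, mul_sub, sub_mul, Finset.sum_sub_distrib, gibbs]
  exact congrArg₂ (· - ·) (by ring) (Finset.sum_congr rfl fun l _ => by ring)

lemma continuous_softMax {β : ℝ} (hβ : 0 < β) : Continuous (softMax β : (ι → ℝ) → ℝ) :=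
  continuous_iff_continuousAt.2 fun z => (hasFDerivAt_softMax hβ z).continuousAt

lemma continuous_gibbs {β : ℝ} (hβ : 0 < β) (k : ι) : Continuous (gibbs β k) := by
  have := continuous_softMax (ι := ι) hβ
  unfold gibbs; fun_prop

lemma continuous_gibbsHess [DecidableEq ι] {β : ℝ} (hβ : 0 < β) (k l : ι) :
    Continuous (gibbsHess β k l) := by
  have h1 := continuous_gibbs hβ k
  have h2 := continuous_gibbs hβ l
  unfold gibbsHess; fun_prop

lemma abs_gibbsHess_le [DecidableEq ι] {β : ℝ} (hβ : 0 < β) (k l : ι) (z : ι → ℝ) :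
    |gibbsHess β k l z| ≤ β := by
  have h1 := gibbs_pos β k z
  have h2 := gibbs_le_one hβ k z
  have h3 := gibbs_pos β l z
  have h4 := gibbs_le_one hβ l z
  rw [gibbsHess, abs_mul, abs_mul, abs_of_pos hβ, abs_of_pos h1]
  have : |(if k = l then (1 : ℝ) else 0) - gibbs β l z| ≤ 1 := by
    rw [abs_le]; split_ifs <;> constructor <;> linarith
  calc β * gibbs β k z * |_| ≤ β * 1 * 1 := by gcongr
    _ = β := by ring

lemma isSmoothExp_softMax [DecidableEq ι] {β : ℝ} (hβ : 0 < β) :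
    IsSmoothExp (softMax β : (ι → ℝ) → ℝ) (gibbs β) (gibbsHess β)
      (1 + Real.log (Fintype.card ι) / β + β) 1 := by
  have hlog := div_nonneg (log_card_nonneg (ι := ι)) hβ.le
  have hge : ∀ z : ι → ℝ, 1 + ∑ k, |z k| ≤ Real.exp (1 * ∑ k, |z k|) := fun z => by
    rw [one_mul]; linarith [Real.add_one_le_exp (∑ k, |z k|)]
  have hs : ∀ z : ι → ℝ, 0 ≤ ∑ k, |z k| := fun z => Finset.sum_nonneg fun _ _ => abs_nonneg _
  refine ⟨by positivity, zero_le_one, hasFDerivAt_softMax hβ, hasFDerivAt_gibbs hβ,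
    continuous_gibbsHess hβ, fun z => ?_, fun k z => ?_, fun k l z => ?_⟩
  · have h1 := softMax_le_sum hβ z
    have h2 := neg_sum_le_softMax hβ z
    have h3 : |softMax β z| ≤ ∑ k, |z k| + Real.log (Fintype.card ι) / β := by
      rw [abs_le]; constructor <;> linarith
    nlinarith [hge z, hs z, mul_nonneg hlog (hs z), mul_nonneg hβ.le (hs z)]
  · rw [abs_of_pos (gibbs_pos β k z)]
    nlinarith [gibbs_le_one hβ k z, hge z, hs z]
  · nlinarith [abs_gibbsHess_le hβ k l z, hge z, hs z]

end

section Marginal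

variable {E₁ E₂ : Type*} [Fintype E₁] [Fintype E₂]

lemma measurePreserving_comp_inl : MeasurePreserving (fun g : E₁ ⊕ E₂ → ℝ => g ∘ Sum.inl)
    (_root_.stdGaussian (E₁ ⊕ E₂)) (_root_.stdGaussian E₁) :=
  measurePreserving_fst.comp
    (measurePreserving_sumPiEquivProdPi (X := fun _ : E₁ ⊕ E₂ => ℝ) fun _ => gaussianReal 0 1)

lemma measurePreserving_comp_inr : MeasurePreserving (fun g : E₁ ⊕ E₂ → ℝ => g ∘ Sum.inr)
    (_root_.stdGaussian (E₁ ⊕ E₂)) (_root_.stdGaussian E₂) :=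
  measurePreserving_snd.comp
    (measurePreserving_sumPiEquivProdPi (X := fun _ : E₁ ⊕ E₂ => ℝ) fun _ => gaussianReal 0 1)

lemma integral_comp_inl {f : (E₁ → ℝ) → ℝ} (hf : Continuous f) :
    ∫ g, f (g ∘ Sum.inl) ∂(_root_.stdGaussian (E₁ ⊕ E₂)) = ∫ g, f g ∂(_root_.stdGaussian E₁) := by
  rw [← (measurePreserving_comp_inl (E₁ := E₁) (E₂ := E₂)).map_eq,
    integral_map measurePreserving_comp_inl.measurable.aemeasurable hf.aestronglyMeasurable]

lemma integral_comp_inr {f : (E₂ → ℝ) → ℝ} (hf : Continuous f) :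
    ∫ g, f (g ∘ Sum.inr) ∂(_root_.stdGaussian (E₁ ⊕ E₂)) = ∫ g, f g ∂(_root_.stdGaussian E₂) := by
  rw [← (measurePreserving_comp_inr (E₁ := E₁) (E₂ := E₂)).map_eq,
    integral_map measurePreserving_comp_inr.measurable.aemeasurable hf.aestronglyMeasurable]

lemma integral_mul_sum (f : (E₁ → ℝ) → ℝ) (h : (E₂ → ℝ) → ℝ) :
    ∫ g, f (g ∘ Sum.inl) * h (g ∘ Sum.inr) ∂(_root_.stdGaussian (E₁ ⊕ E₂))
      = (∫ g, f g ∂(_root_.stdGaussian E₁)) * ∫ g, h g ∂(_root_.stdGaussian E₂) := by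
  have mp := measurePreserving_sumPiEquivProdPi (X := fun _ : E₁ ⊕ E₂ => ℝ)
    fun _ => gaussianReal 0 1
  rw [← integral_prod_mul]
  exact mp.integral_comp' (f := MeasurableEquiv.sumPiEquivProdPi (fun _ : E₁ ⊕ E₂ => ℝ))
    (fun z : (E₁ → ℝ) × (E₂ → ℝ) => f z.1 * h z.2)

end Marginal

section Comparison

variable {ι : Type*} [Fintype ι] [Nonempty ι]

lemma gibbsHess_quadratic_nonneg [DecidableEq ι] {β : ℝ} (hβ : 0 < β) (z : ι → ℝ)
    {R : ι → ι → ℝ} (hR : ∀ k l, 0 ≤ R k k + R l l - R k l - R l k) :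
    0 ≤ ∑ k, ∑ l, R k l * gibbsHess β k l z := by
  set p := fun k => gibbs β k z with hp
  have h1 : ∑ k, p k = 1 := sum_gibbs hβ z
  have h2 : ∑ k, ∑ l, R k l * gibbsHess β k l z
      = β * (∑ k, p k * R k k - ∑ k, ∑ l, p k * p l * R k l) := by
    rw [← Finset.sum_sub_distrib, Finset.mul_sum]
    refine Finset.sum_congr rfl fun k _ => ?_
    simp only [gibbsHess]
    simp only [mul_sub, Finset.sum_sub_distrib, mul_ite, mul_one, mul_zero, Finset.sum_ite_eq,
      Finset.mem_univ, if_true, Finset.mul_sum]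
    congr 1
    · ring
    · exact Finset.sum_congr rfl fun l _ => by ring
  have h3 : ∑ k, p k * R k k = ∑ k, ∑ l, p k * p l * R k k := by
    refine Finset.sum_congr rfl fun k _ => ?_
    rw [← Finset.sum_mul, ← Finset.mul_sum, h1, mul_one]
  have h4 : ∑ k, p k * R k k = ∑ k, ∑ l, p k * p l * R l l := by
    rw [h3, Finset.sum_comm]
    exact Finset.sum_congr rfl fun k _ => Finset.sum_congr rfl fun l _ => by ring
  have h5 : ∑ k, ∑ l, p k * p l * R k l = ∑ k, ∑ l, p k * p l * R l k := by
    rw [Finset.sum_comm]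
    exact Finset.sum_congr rfl fun k _ => Finset.sum_congr rfl fun l _ => by ring
  have h6 : 0 ≤ ∑ k, ∑ l, p k * p l * (R k k + R l l - R k l - R l k) :=
    Finset.sum_nonneg fun k _ => Finset.sum_nonneg fun l _ =>
      mul_nonneg (mul_nonneg (gibbs_pos β k z).le (gibbs_pos β l z).le) (hR k l)
  simp only [mul_add, mul_sub, Finset.sum_add_distrib, Finset.sum_sub_distrib] at h6
  rw [h2]
  refine mul_nonneg hβ.le ?_
  linarith

variable {E : Type*} [Fintype E]

lemma integral_softMax_le_of_orthogonal {β : ℝ} (hβ : 0 < β) {u v : ι → E → ℝ}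
    (huv : ∀ k l, ∑ e, u k e * v l e = 0)
    (hinc : ∀ k l, ∑ e, (u k e - u l e) ^ 2 ≤ ∑ e, (v k e - v l e) ^ 2) :
    ∫ g, softMax β (linImage u g) ∂(_root_.stdGaussian E)
      ≤ ∫ g, softMax β (linImage v g) ∂(_root_.stdGaussian E) := by
  classical
  have hS := isSmoothExp_softMax (ι := ι) hβ
  have hd := hS.hasDerivAt_integral_rotation u v huv
  have hmono := monotoneOn_of_deriv_nonneg (convex_Icc 0 (Real.pi / 2))
    (continuousOn_of_forall_continuousAt fun θ _ => (hd θ).continuousAt)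
    (fun θ _ => (hd θ).differentiableAt.differentiableWithinAt)
    (fun θ hθ => by
      rw [interior_Icc] at hθ
      rw [(hd θ).deriv]
      refine mul_nonneg (mul_nonneg (Real.sin_nonneg_of_nonneg_of_le_pi hθ.1.le
        (by linarith [hθ.2, Real.pi_pos])) (Real.cos_nonneg_of_neg_pi_div_two_le_of_le
        (by linarith [hθ.1, Real.pi_pos]) hθ.2.le)) ?_
      simp_rw [← integral_const_mul]
      have hint : ∀ k l, Integrable (fun g => gibbsHess β k l
          (linImage (fun k e => Real.cos θ * u k e + Real.sin θ * v k e) g))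
          (_root_.stdGaussian E) := fun k l =>
        integrable_comp_linImage (hS.continuous_hess k l) hS.nonneg_B hS.nonneg_c
          (hS.bound_hess k l) _
      have : ∀ k : ι, ∑ l, ∫ g, (∑ e, v k e * v l e - ∑ e, u k e * u l e) * gibbsHess β k l
          (linImage (fun k e => Real.cos θ * u k e + Real.sin θ * v k e) g) ∂(_root_.stdGaussian E)
          = ∫ g, ∑ l, (∑ e, v k e * v l e - ∑ e, u k e * u l e) * gibbsHess β k l
          (linImage (fun k e => Real.cos θ * u k e + Real.sin θ * v k e) g)
            ∂(_root_.stdGaussian E) := fun k =>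
        (integral_finsetSum _ fun l _ => (hint k l).const_mul _).symm
      simp_rw [this]
      rw [← integral_finsetSum _ fun k _ =>
        integrable_finsetSum _ fun l _ => (hint k l).const_mul _]
      refine integral_nonneg fun g => gibbsHess_quadratic_nonneg hβ _ fun k l => ?_
      have h := hinc k l
      have ex : ∀ w : ι → E → ℝ, ∑ e, (w k e - w l e) ^ 2 = ∑ e, w k e * w k e
          + ∑ e, w l e * w l e - ∑ e, w k e * w l e - ∑ e, w l e * w k e := by
        intro w
        simp_rw [← Finset.sum_add_distrib, ← Finset.sum_sub_distrib]
        exact Finset.sum_congr rfl fun e _ => by ring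
      rw [ex u, ex v] at h
      linarith)
  have := hmono (Set.left_mem_Icc.2 (by positivity)) (Set.right_mem_Icc.2 (by positivity))
    (by positivity : (0 : ℝ) ≤ Real.pi / 2)
  simpa using this

omit [Fintype ι] [Nonempty ι] in
lemma linImage_elim_zero_right {E' : Type*} [Fintype E'] (u : ι → E → ℝ) (g : E ⊕ E' → ℝ) :
    linImage (fun k => Sum.elim (u k) (0 : E' → ℝ)) g = linImage u (g ∘ Sum.inl) := by
  ext k; simp [linImage]

omit [Fintype ι] [Nonempty ι] in
lemma linImage_elim_zero_left {E' : Type*} [Fintype E'] (u : ι → E → ℝ) (g : E' ⊕ E → ℝ) :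
    linImage (fun k => Sum.elim (0 : E' → ℝ) (u k)) g = linImage u (g ∘ Sum.inr) := by
  ext k; simp [linImage]

/-- Sudakov–Fernique comparison for the free energy. -/
lemma integral_softMax_le {E' : Type*} [Fintype E'] {β : ℝ} (hβ : 0 < β) {u : ι → E → ℝ}
    {v : ι → E' → ℝ}
    (hinc : ∀ k l, ∑ e, (u k e - u l e) ^ 2 ≤ ∑ e, (v k e - v l e) ^ 2) :
    ∫ g, softMax β (linImage u g) ∂(_root_.stdGaussian E)
      ≤ ∫ g, softMax β (linImage v g) ∂(_root_.stdGaussian E') := by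
  have h := integral_softMax_le_of_orthogonal hβ
    (u := fun k => Sum.elim (u k) (0 : E' → ℝ)) (v := fun k => Sum.elim (0 : E → ℝ) (v k))
    (fun k l => by simp) (fun k l => by simpa using hinc k l)
  simp_rw [linImage_elim_zero_right, linImage_elim_zero_left] at h
  rwa [integral_comp_inl (f := fun g => softMax β (linImage u g))
      ((continuous_softMax hβ).comp (continuous_linImage u)),
    integral_comp_inr (f := fun g => softMax β (linImage v g))
      ((continuous_softMax hβ).comp (continuous_linImage v))] at h

lemma continuous_ciSup_apply : Continuous fun z : ι → ℝ => ⨆ k, z k := by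
  simp_rw [← Finset.sup'_univ_eq_ciSup]
  exact Continuous.finset_sup'_apply _ fun k _ => continuous_apply k

omit [Nonempty ι] in
lemma le_ciSup_finite (z : ι → ℝ) (k : ι) : z k ≤ ⨆ l, z l :=
  le_ciSup (Set.finite_range z).bddAbove k

lemma abs_ciSup_le (z : ι → ℝ) : |⨆ k, z k| ≤ ∑ k, |z k| := by
  rw [abs_le]
  constructor
  · obtain ⟨k⟩ := ‹Nonempty ι›
    have := le_ciSup_finite z k
    have h2 := abs_le_sum_abs z k
    linarith [neg_abs_le (z k)]
  · exact ciSup_le fun k => (le_abs_self _).trans (abs_le_sum_abs z k)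

lemma integrable_ciSup_linImage (u : ι → E → ℝ) :
    Integrable (fun g => ⨆ k, linImage u g k) (_root_.stdGaussian E) :=
  integrable_comp_linImage continuous_ciSup_apply zero_le_one zero_le_one (fun z => by
    have := abs_ciSup_le z
    rw [one_mul, one_mul]
    linarith [Real.add_one_le_exp (∑ k, |z k|)]) u

lemma integrable_softMax_linImage {β : ℝ} (hβ : 0 < β) (u : ι → E → ℝ) :
    Integrable (fun g => softMax β (linImage u g)) (_root_.stdGaussian E) := by
  classical
  have hS := isSmoothExp_softMax (ι := ι) hβ
  exact integrable_comp_linImage hS.continuous hS.nonneg_B hS.nonneg_c hS.bound u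

lemma integral_softMax_le_integral_ciSup {β : ℝ} (hβ : 0 < β) (u : ι → E → ℝ) :
    ∫ g, softMax β (linImage u g) ∂(_root_.stdGaussian E)
      ≤ (∫ g, ⨆ k, linImage u g k ∂(_root_.stdGaussian E)) + Real.log (Fintype.card ι) / β := by
  calc ∫ g, softMax β (linImage u g) ∂(_root_.stdGaussian E)
      ≤ ∫ g, ((⨆ k, linImage u g k) + Real.log (Fintype.card ι) / β) ∂(_root_.stdGaussian E) :=
        integral_mono (integrable_softMax_linImage hβ u)
          ((integrable_ciSup_linImage u).add (integrable_const _))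
          fun g => softMax_le hβ fun k => le_ciSup_finite _ k
    _ = _ := by
        rw [integral_add (integrable_ciSup_linImage u) (integrable_const _)]; simp

lemma integral_ciSup_le_integral_softMax {β : ℝ} (hβ : 0 < β) (u : ι → E → ℝ) :
    ∫ g, ⨆ k, linImage u g k ∂(_root_.stdGaussian E)
      ≤ ∫ g, softMax β (linImage u g) ∂(_root_.stdGaussian E) :=
  integral_mono (integrable_ciSup_linImage u) (integrable_softMax_linImage hβ u)
    fun _ => ciSup_le fun k => le_softMax hβ _ k

lemma le_of_forall_le_add_div {x y L : ℝ} (hL : 0 ≤ L) (h : ∀ β : ℝ, 0 < β → x ≤ y + L / β) :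
    x ≤ y := by
  refine le_of_forall_pos_le_add fun ε hε => ?_
  have := h ((L + 1) / ε) (by positivity)
  refine this.trans (add_le_add le_rfl ?_)
  rw [div_div_eq_mul_div, div_le_iff₀ (by positivity)]
  nlinarith

/-- The **Sudakov–Fernique inequality** for finite Gaussian families. -/
theorem integral_ciSup_linImage_le {E' : Type*} [Fintype E'] {u : ι → E → ℝ} {v : ι → E' → ℝ}
    (hinc : ∀ k l, ∑ e, (u k e - u l e) ^ 2 ≤ ∑ e, (v k e - v l e) ^ 2) :
    ∫ g, ⨆ k, linImage u g k ∂(_root_.stdGaussian E)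
      ≤ ∫ g, ⨆ k, linImage v g k ∂(_root_.stdGaussian E') :=
  le_of_forall_le_add_div log_card_nonneg fun _ hβ =>
    (integral_ciSup_le_integral_softMax hβ u).trans
      ((integral_softMax_le hβ hinc).trans (integral_softMax_le_integral_ciSup hβ v))

end Comparison

section

variable {ι E : Type*} [Fintype ι] [Fintype E]

namespace IsSmoothExp

lemma exp {G : (ι → ℝ) → ℝ} {q : ι → (ι → ℝ) → ℝ} {h : ι → ι → (ι → ℝ) → ℝ} {C β t : ℝ}
    (ht : 0 ≤ t) (hβ : 0 ≤ β)
    (hG : ∀ z, HasFDerivAt G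
      (∑ k, q k z • (ContinuousLinearMap.proj k : (ι → ℝ) →L[ℝ] ℝ)) z)
    (hq : ∀ k z, HasFDerivAt (q k)
      (∑ l, h k l z • (ContinuousLinearMap.proj l : (ι → ℝ) →L[ℝ] ℝ)) z)
    (hh : ∀ k l, Continuous (h k l)) (bG : ∀ z, G z ≤ C + ∑ k, |z k|) (bq : ∀ k z, |q k z| ≤ 1)
    (bh : ∀ k l z, |h k l z| ≤ β) :
    IsSmoothExp (fun z => Real.exp (t * G z)) (fun k z => t * q k z * Real.exp (t * G z))
      (fun k l z => (t * h k l z + t ^ 2 * q k z * q l z) * Real.exp (t * G z))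
      ((1 + t + t * β + t ^ 2) * Real.exp (t * C)) t := by
  have cG : Continuous G := continuous_iff_continuousAt.2 fun z => (hG z).continuousAt
  have cq : ∀ k, Continuous (q k) := fun k =>
    continuous_iff_continuousAt.2 fun z => (hq k z).continuousAt
  have hexp : ∀ z, Real.exp (t * G z) ≤ Real.exp (t * C) * Real.exp (t * ∑ k, |z k|) := fun z => by
    rw [← Real.exp_add, ← mul_add]
    exact Real.exp_le_exp.2 (mul_le_mul_of_nonneg_left (bG z) ht)
  have hbd : ∀ x z, |x| ≤ 1 + t + t * β + t ^ 2 → |x * Real.exp (t * G z)|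
      ≤ (1 + t + t * β + t ^ 2) * Real.exp (t * C) * Real.exp (t * ∑ k, |z k|) := fun x z hx => by
    rw [abs_mul, Real.abs_exp, mul_assoc]
    exact mul_le_mul hx (hexp z) (Real.exp_pos _).le (by positivity)
  have htβ : 0 ≤ t * β := mul_nonneg ht hβ
  have hE : ∀ z, HasFDerivAt (fun z => Real.exp (t * G z))
      (Real.exp (t * G z) • t • ∑ k, q k z • (ContinuousLinearMap.proj k : (ι → ℝ) →L[ℝ] ℝ)) z :=
    fun z => ((hG z).const_mul t).exp
  refine ⟨by positivity, ht, fun z => ?_, fun k z => ?_, fun k l => ?_, fun z => ?_,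
    fun k z => ?_, fun k l z => ?_⟩
  · convert! hE z using 1
    simp_rw [Finset.smul_sum, smul_smul]
    exact Finset.sum_congr rfl fun k _ => by congr 1; ring
  · convert! ((hq k z).const_mul t).mul (hE z) using 1
    simp_rw [Finset.smul_sum, smul_smul, ← Finset.sum_add_distrib, ← add_smul]
    exact Finset.sum_congr rfl fun k _ => by congr 1; ring
  · have := hh k l
    have := cq k
    have := cq l
    fun_prop
  · have := hbd 1 z (by rw [abs_one]; nlinarith)
    rwa [one_mul] at this
  · refine hbd _ z ?_
    rw [abs_mul, abs_of_nonneg ht]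
    nlinarith [bq k z]
  · refine hbd _ z ?_
    refine (abs_add_le _ _).trans ?_
    rw [abs_mul, abs_mul, abs_mul, abs_of_nonneg ht, abs_of_nonneg (sq_nonneg t)]
    have h1 := mul_le_mul_of_nonneg_left (bh k l z) ht
    have h2 : |q k z| * |q l z| ≤ 1 := mul_le_one₀ (bq k z) (abs_nonneg _) (bq l z)
    nlinarith [sq_nonneg t]

variable {Φ : (ι → ℝ) → ℝ} {D : ι → (ι → ℝ) → ℝ} {H : ι → ι → (ι → ℝ) → ℝ} {B c : ℝ}

/-- Gaussian interpolation with a Grönwall-type lower bound on the derivative. -/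
lemma integral_le_exp_mul_integral (h : IsSmoothExp Φ D H B c) {u v : ι → E → ℝ} {K : ℝ}
    (huv : ∀ k l, ∑ e, u k e * v l e = 0)
    (hK : ∀ z, -(2 * K * Φ z)
      ≤ ∑ k, ∑ l, (∑ e, v k e * v l e - ∑ e, u k e * u l e) * H k l z) :
    ∫ g, Φ (linImage u g) ∂(_root_.stdGaussian E)
      ≤ Real.exp K * ∫ g, Φ (linImage v g) ∂(_root_.stdGaussian E) := by
  have hd := fun θ => (h.hasDerivAt_integral_rotation u v huv θ).mul
    ((((Real.hasDerivAt_sin θ).pow 2).const_mul K).exp)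
  have hmono := monotoneOn_of_deriv_nonneg (convex_Icc 0 (Real.pi / 2))
    (continuousOn_of_forall_continuousAt fun θ _ => (hd θ).continuousAt)
    (fun θ _ => (hd θ).differentiableAt.differentiableWithinAt)
    (fun θ hθ => by
      rw [interior_Icc] at hθ
      rw [(hd θ).deriv]
      have hs : 0 ≤ Real.sin θ * Real.cos θ :=
        mul_nonneg (Real.sin_nonneg_of_nonneg_of_le_pi hθ.1.le
        (by linarith [hθ.2, Real.pi_pos])) (Real.cos_nonneg_of_neg_pi_div_two_le_of_le
        (by linarith [hθ.1, Real.pi_pos]) hθ.2.le)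
      set w : ι → E → ℝ := fun k e => Real.cos θ * u k e + Real.sin θ * v k e
      have hint : ∀ k l, Integrable (fun g => H k l (linImage w g)) (_root_.stdGaussian E) :=
        fun k l => integrable_comp_linImage (h.continuous_hess k l) h.nonneg_B h.nonneg_c
          (h.bound_hess k l) _
      have hΦ : Integrable (fun g => Φ (linImage w g)) (_root_.stdGaussian E) :=
        integrable_comp_linImage h.continuous h.nonneg_B h.nonneg_c h.bound _
      have key : -(2 * K * ∫ g, Φ (linImage w g) ∂(_root_.stdGaussian E))
          ≤ ∑ k, ∑ l, (∑ e, v k e * v l e - ∑ e, u k e * u l e) *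
            ∫ g, H k l (linImage w g) ∂(_root_.stdGaussian E) := by
        have h1 := integral_mono (hΦ.const_mul (2 * K)).neg (integrable_finsetSum _ fun k _ =>
          integrable_finsetSum _ fun l _ =>
            (hint k l).const_mul (∑ e, v k e * v l e - ∑ e, u k e * u l e))
          (fun g => hK (linImage w g))
        simp_rw [← integral_const_mul]
        rw [← integral_neg]
        refine h1.trans (le_of_eq ?_)
        rw [integral_finsetSum _ fun k _ => integrable_finsetSum _ fun l _ =>
          (hint k l).const_mul _]
        exact Finset.sum_congr rfl fun k _ =>
          integral_finsetSum _ fun l _ => (hint k l).const_mul _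
      have h2 := mul_le_mul_of_nonneg_left key hs
      have h3 := mul_nonneg (sub_nonneg.2 h2) (Real.exp_pos (K * Real.sin θ ^ 2)).le
      refine h3.trans (le_of_eq ?_)
      simp only [Pi.pow_apply]
      push_cast
      ring)
  have := hmono (Set.left_mem_Icc.2 (by positivity)) (Set.right_mem_Icc.2 (by positivity))
    (by positivity : (0 : ℝ) ≤ Real.pi / 2)
  simpa [mul_comm] using this

end IsSmoothExp

end

section

variable {ι κ E : Type*} [Fintype ι] [Fintype κ] [Fintype E]

lemma hasFDerivAt_comp_inl {f : (ι → ℝ) → ℝ} {q : ι → ℝ} {z : ι ⊕ κ → ℝ}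
    (hf : HasFDerivAt f (∑ k, q k • (ContinuousLinearMap.proj k : (ι → ℝ) →L[ℝ] ℝ))
      (z ∘ Sum.inl)) :
    HasFDerivAt (fun z : ι ⊕ κ → ℝ => f (z ∘ Sum.inl))
      (∑ k : ι, q k • (ContinuousLinearMap.proj (Sum.inl k) : (ι ⊕ κ → ℝ) →L[ℝ] ℝ)) z := by
  have h1 : HasFDerivAt (fun z : ι ⊕ κ → ℝ => z ∘ Sum.inl)
      (ContinuousLinearMap.pi fun k =>
        (ContinuousLinearMap.proj (Sum.inl k) : (ι ⊕ κ → ℝ) →L[ℝ] ℝ)) z :=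
    hasFDerivAt_pi.2 fun k => hasFDerivAt_apply (Sum.inl k) z
  convert! hf.comp z h1 using 1
  ext y; simp

lemma hasFDerivAt_comp_inr {f : (κ → ℝ) → ℝ} {q : κ → ℝ} {z : ι ⊕ κ → ℝ}
    (hf : HasFDerivAt f (∑ k, q k • (ContinuousLinearMap.proj k : (κ → ℝ) →L[ℝ] ℝ))
      (z ∘ Sum.inr)) :
    HasFDerivAt (fun z : ι ⊕ κ → ℝ => f (z ∘ Sum.inr))
      (∑ k : κ, q k • (ContinuousLinearMap.proj (Sum.inr k) : (ι ⊕ κ → ℝ) →L[ℝ] ℝ)) z := by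
  have h1 : HasFDerivAt (fun z : ι ⊕ κ → ℝ => z ∘ Sum.inr)
      (ContinuousLinearMap.pi fun k =>
        (ContinuousLinearMap.proj (Sum.inr k) : (ι ⊕ κ → ℝ) →L[ℝ] ℝ)) z :=
    hasFDerivAt_pi.2 fun k => hasFDerivAt_apply (Sum.inr k) z
  convert! hf.comp z h1 using 1
  ext y; simp

variable [Nonempty ι]

lemma isSmoothExp_exp_softMax_sub [DecidableEq ι] {β t : ℝ} (hβ : 0 < β) (ht : 0 ≤ t) :
    IsSmoothExp
      (fun z : ι ⊕ ι → ℝ => Real.exp (t * (softMax β (z ∘ Sum.inl) - softMax β (z ∘ Sum.inr))))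
      (fun k z => t * (Sum.elim (fun k => gibbs β k (z ∘ Sum.inl))
        (fun k => -gibbs β k (z ∘ Sum.inr)) k) *
        Real.exp (t * (softMax β (z ∘ Sum.inl) - softMax β (z ∘ Sum.inr))))
      (fun k l z => (t * (Sum.elim
          (fun k => Sum.elim (fun l => gibbsHess β k l (z ∘ Sum.inl)) 0)
          (fun k => Sum.elim 0 (fun l => -gibbsHess β k l (z ∘ Sum.inr))) k l) +
        t ^ 2 * (Sum.elim (fun k => gibbs β k (z ∘ Sum.inl))
          (fun k => -gibbs β k (z ∘ Sum.inr)) k) *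
          (Sum.elim (fun k => gibbs β k (z ∘ Sum.inl)) (fun k => -gibbs β k (z ∘ Sum.inr)) l)) *
        Real.exp (t * (softMax β (z ∘ Sum.inl) - softMax β (z ∘ Sum.inr))))
      ((1 + t + t * β + t ^ 2) * Real.exp (t * (Real.log (Fintype.card ι) / β))) t := by
  have cl : Continuous fun z : ι ⊕ ι → ℝ => z ∘ Sum.inl := by fun_prop
  have cr : Continuous fun z : ι ⊕ ι → ℝ => z ∘ Sum.inr := by fun_prop
  have hg : ∀ (k : ι) (z : ι → ℝ), |gibbs β k z| ≤ 1 := fun k z => by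
    rw [abs_of_pos (gibbs_pos β k z)]; exact gibbs_le_one hβ k z
  refine IsSmoothExp.exp (G := fun z => softMax β (z ∘ Sum.inl) - softMax β (z ∘ Sum.inr))
    (q := fun k z => Sum.elim (fun k => gibbs β k (z ∘ Sum.inl))
      (fun k => -gibbs β k (z ∘ Sum.inr)) k)
    (h := fun k l z => Sum.elim (fun k => Sum.elim (fun l => gibbsHess β k l (z ∘ Sum.inl)) 0)
      (fun k => Sum.elim 0 (fun l => -gibbsHess β k l (z ∘ Sum.inr))) k l)
    (C := Real.log (Fintype.card ι) / β) ht hβ.le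
    (fun z => ?_) (fun k z => ?_) (fun k l => ?_) (fun z => ?_) (fun k z => ?_) (fun k l z => ?_)
  · convert! (hasFDerivAt_comp_inl (κ := ι) (hasFDerivAt_softMax hβ (z ∘ Sum.inl))).sub
      (hasFDerivAt_comp_inr (hasFDerivAt_softMax hβ (z ∘ Sum.inr))) using 1
    ext y; simp [Fintype.sum_sum_type, sub_eq_add_neg]
  · cases k with
    | inl k =>
      convert! hasFDerivAt_comp_inl (κ := ι) (hasFDerivAt_gibbs hβ k (z ∘ Sum.inl)) using 1
      simp [Fintype.sum_sum_type]
    | inr k =>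
      convert! (hasFDerivAt_comp_inr (ι := ι) (hasFDerivAt_gibbs hβ k (z ∘ Sum.inr))).neg using 1
      ext y; simp [Fintype.sum_sum_type]
  · rcases k with k | k <;> rcases l with l | l
    · exact (continuous_gibbsHess hβ k l).comp cl
    · exact continuous_const
    · exact continuous_const
    · exact ((continuous_gibbsHess hβ k l).comp cr).neg
  · have h1 := softMax_le_sum hβ (z ∘ Sum.inl)
    have h2 := neg_sum_le_softMax hβ (z ∘ Sum.inr)
    rw [Fintype.sum_sum_type]
    simp only [Function.comp_apply] at h1 h2
    linarith
  · rcases k with k | k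
    · exact hg _ _
    · simpa using hg k _
  · rcases k with k | k <;> rcases l with l | l
    · exact abs_gibbsHess_le hβ k l _
    · simpa using hβ.le
    · simpa using hβ.le
    · simpa using abs_gibbsHess_le hβ k l (z ∘ Sum.inr)

omit [Fintype ι] [Nonempty ι] in
lemma sum_mul_le_of_sum_sq_le {x : ι → E → ℝ} {σ : ℝ} (hx : ∀ k, ∑ e, x k e ^ 2 ≤ σ ^ 2)
    (k l : ι) : ∑ e, x k e * x l e ≤ σ ^ 2 := by
  have : ∑ e, x k e * x l e ≤ ∑ e, (x k e ^ 2 + x l e ^ 2) / 2 :=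
    Finset.sum_le_sum fun e _ => by nlinarith [sq_nonneg (x k e - x l e)]
  rw [← Finset.sum_div, Finset.sum_add_distrib] at this
  linarith [hx k, hx l]

lemma integrable_exp_mul_softMax {β : ℝ} (hβ : 0 < β) (t : ℝ) (x : ι → E → ℝ) :
    Integrable (fun g => Real.exp (t * softMax β (linImage x g))) (_root_.stdGaussian E) := by
  have hlog := div_nonneg (log_card_nonneg (ι := ι)) hβ.le
  refine integrable_comp_linImage (f := fun z => Real.exp (t * softMax β z))
    (B := Real.exp (|t| * (Real.log (Fintype.card ι) / β))) (c := |t|)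
    (Real.continuous_exp.comp (continuous_const.mul (continuous_softMax hβ)))
    (Real.exp_pos _).le (abs_nonneg t) (fun z => ?_) x
  have h1 := softMax_le_sum hβ z
  have h2 := neg_sum_le_softMax hβ z
  rw [Real.abs_exp, ← Real.exp_add, ← mul_add]
  refine Real.exp_le_exp.2 ((le_abs_self _).trans ?_)
  rw [abs_mul]
  refine mul_le_mul_of_nonneg_left ?_ (abs_nonneg t)
  rw [abs_le]; constructor <;> linarith

lemma exp_mul_integral_softMax_le {β : ℝ} (hβ : 0 < β) (t : ℝ) (x : ι → E → ℝ) :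
    Real.exp (t * ∫ g, softMax β (linImage x g) ∂(_root_.stdGaussian E))
      ≤ ∫ g, Real.exp (t * softMax β (linImage x g)) ∂(_root_.stdGaussian E) := by
  set M := ∫ g, softMax β (linImage x g) ∂(_root_.stdGaussian E)
  have hF := integrable_softMax_linImage hβ x
  have hFM : Integrable (fun g => t * (softMax β (linImage x g) - M)) (_root_.stdGaussian E) :=
    (hF.sub (integrable_const _)).const_mul t
  have h : ∫ g, Real.exp (t * M) * (1 + t * (softMax β (linImage x g) - M))
        ∂(_root_.stdGaussian E)
      ≤ ∫ g, Real.exp (t * softMax β (linImage x g)) ∂(_root_.stdGaussian E) := by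
    refine integral_mono
      (((integrable_const _).add hFM).const_mul _)
      (integrable_exp_mul_softMax hβ t x) fun g => ?_
    have h1 := Real.add_one_le_exp (t * (softMax β (linImage x g) - M))
    have h2 : Real.exp (t * softMax β (linImage x g))
        = Real.exp (t * M) * Real.exp (t * (softMax β (linImage x g) - M)) := by
      rw [← Real.exp_add]; congr 1; ring
    simp only [h2]
    exact mul_le_mul_of_nonneg_left (by linarith) (Real.exp_pos _).le
  refine le_trans (le_of_eq ?_) h
  rw [integral_const_mul, integral_add (integrable_const _) hFM, integral_const_mul,
    integral_sub hF (integrable_const _)]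
  simp [M]

/-- Gaussian concentration: sub-Gaussian bound for the moment generating function of the
free energy. -/
lemma integral_exp_mul_softMax_le {β t σ : ℝ} (hβ : 0 < β) (ht : 0 ≤ t) {x : ι → E → ℝ}
    (hx : ∀ k, ∑ e, x k e ^ 2 ≤ σ ^ 2) :
    ∫ g, Real.exp (t * softMax β (linImage x g)) ∂(_root_.stdGaussian E)
      ≤ Real.exp (t * (∫ g, softMax β (linImage x g) ∂(_root_.stdGaussian E))
        + t ^ 2 * σ ^ 2) := by
  classical
  have h := (isSmoothExp_exp_softMax_sub (ι := ι) hβ ht).integral_le_exp_mul_integral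
    (E := E ⊕ (E ⊕ E)) (K := t ^ 2 * σ ^ 2)
    (u := Sum.elim (fun k => Sum.elim 0 (Sum.elim (x k) 0))
      (fun k => Sum.elim 0 (Sum.elim 0 (x k))))
    (v := Sum.elim (fun k => Sum.elim (x k) 0) (fun k => Sum.elim (x k) 0))
    (fun k l => by rcases k with k | k <;> rcases l with l | l <;> simp)
    (fun z => by
      simp only [Fintype.sum_sum_type, Sum.elim_inl, Sum.elim_inr, Pi.zero_apply, mul_zero,
        zero_mul, Finset.sum_const_zero, add_zero, zero_add, sub_self, sub_zero]
      set Φ := Real.exp (t * (softMax β (z ∘ Sum.inl) - softMax β (z ∘ Sum.inr)))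
      have hΦ : 0 < Φ := Real.exp_pos _
      have key : ∀ p r : ι → ℝ, (∀ k, 0 ≤ p k) → (∀ k, 0 ≤ r k) → ∑ k, p k = 1 → ∑ k, r k = 1 →
          -(t ^ 2 * σ ^ 2 * Φ)
            ≤ ∑ k, ∑ l, (∑ e, x k e * x l e) * (-(t ^ 2 * p k * r l) * Φ) := by
        intro p r hp hr hp1 hr1
        calc -(t ^ 2 * σ ^ 2 * Φ) = ∑ k, ∑ l, σ ^ 2 * (-(t ^ 2 * p k * r l) * Φ) := by
              have : ∀ k l, σ ^ 2 * (-(t ^ 2 * p k * r l) * Φ)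
                  = p k * (r l * (-(t ^ 2 * σ ^ 2 * Φ))) := fun k l => by ring
              simp_rw [this, ← Finset.mul_sum, ← Finset.sum_mul, hp1, hr1]; ring
          _ ≤ _ := by
              refine Finset.sum_le_sum fun k _ => Finset.sum_le_sum fun l _ => ?_
              have h1 := sum_mul_le_of_sum_sq_le hx k l
              have h2 : 0 ≤ t ^ 2 * p k * r l * Φ :=
                mul_nonneg (mul_nonneg (mul_nonneg (sq_nonneg t) (hp k)) (hr l)) hΦ.le
              nlinarith
      have k1 := key _ _ (fun k => (gibbs_pos β k (z ∘ Sum.inl)).le)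
        (fun k => (gibbs_pos β k (z ∘ Sum.inr)).le) (sum_gibbs hβ _) (sum_gibbs hβ _)
      have k2 := key _ _ (fun k => (gibbs_pos β k (z ∘ Sum.inr)).le)
        (fun k => (gibbs_pos β k (z ∘ Sum.inl)).le) (sum_gibbs hβ _) (sum_gibbs hβ _)
      simp only [mul_neg, neg_mul] at k1 k2 ⊢
      linarith)
  have e1 : ∀ g : E ⊕ (E ⊕ E) → ℝ, linImage (Sum.elim
      (fun k => Sum.elim (0 : E → ℝ) (Sum.elim (x k) (0 : E → ℝ)))
      (fun k => Sum.elim (0 : E → ℝ) (Sum.elim (0 : E → ℝ) (x k)))) g ∘ Sum.inl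
      = linImage x ((g ∘ Sum.inr) ∘ Sum.inl) := fun g => by ext k; simp [linImage]
  have e2 : ∀ g : E ⊕ (E ⊕ E) → ℝ, linImage (Sum.elim
      (fun k => Sum.elim (0 : E → ℝ) (Sum.elim (x k) (0 : E → ℝ)))
      (fun k => Sum.elim (0 : E → ℝ) (Sum.elim (0 : E → ℝ) (x k)))) g ∘ Sum.inr
      = linImage x ((g ∘ Sum.inr) ∘ Sum.inr) := fun g => by ext k; simp [linImage]
  have e3 : ∀ g : E ⊕ (E ⊕ E) → ℝ, linImage (Sum.elim (fun k => Sum.elim (x k) (0 : E ⊕ E → ℝ))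
      (fun k => Sum.elim (x k) (0 : E ⊕ E → ℝ))) g ∘ Sum.inl
      = linImage (Sum.elim (fun k => Sum.elim (x k) (0 : E ⊕ E → ℝ))
      (fun k => Sum.elim (x k) (0 : E ⊕ E → ℝ))) g ∘ Sum.inr := fun g => by
    ext k; simp [linImage]
  simp_rw [e1, e2, e3, sub_self, mul_zero, Real.exp_zero] at h
  have cF : Continuous fun g : E → ℝ => softMax β (linImage x g) :=
    (continuous_softMax hβ).comp (continuous_linImage x)
  rw [integral_comp_inr (f := fun g => Real.exp (t * (softMax β (linImage x (g ∘ Sum.inl))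
    - softMax β (linImage x (g ∘ Sum.inr))))) (by
      have cl : Continuous fun z : E ⊕ E → ℝ => z ∘ Sum.inl := by fun_prop
      have cr : Continuous fun z : E ⊕ E → ℝ => z ∘ Sum.inr := by fun_prop
      have := cF.comp cl
      have := cF.comp cr
      simp only [Function.comp_def] at *
      fun_prop)] at h
  have e4 : ∀ g : E ⊕ E → ℝ, Real.exp (t * (softMax β (linImage x (g ∘ Sum.inl))
      - softMax β (linImage x (g ∘ Sum.inr))))
      = Real.exp (t * softMax β (linImage x (g ∘ Sum.inl)))
        * Real.exp (-t * softMax β (linImage x (g ∘ Sum.inr))) := fun g => by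
    rw [← Real.exp_add]; congr 1; ring
  simp_rw [e4] at h
  rw [integral_mul_sum (fun g => Real.exp (t * softMax β (linImage x g)))
    (fun g => Real.exp (-t * softMax β (linImage x g)))] at h
  have hJ := exp_mul_integral_softMax_le hβ (-t) x
  have hpos : 0 ≤ ∫ g, Real.exp (t * softMax β (linImage x g)) ∂(_root_.stdGaussian E) :=
    integral_nonneg fun g => (Real.exp_pos _).le
  have h2 := (mul_le_mul_of_nonneg_left hJ hpos).trans h
  rw [neg_mul, Real.exp_neg, ← div_eq_mul_inv, div_le_iff₀ (Real.exp_pos _)] at h2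
  refine h2.trans (le_of_eq ?_)
  simp [Real.exp_add, mul_comm]

end

section

variable {J κ E : Type*} [Fintype J] [Nonempty J] [Fintype κ] [Nonempty κ] [Fintype E]

lemma integral_ciSup_prod_le_of_pos {u : J → κ → E → ℝ} {σ M t β : ℝ} (hβ : 0 < β) (ht : 0 < t)
    (hu : ∀ j k, ∑ e, u j k e ^ 2 ≤ σ ^ 2)
    (hM : ∀ j, ∫ g, ⨆ k, linImage (u j) g k ∂(_root_.stdGaussian E) ≤ M) :
    ∫ g, ⨆ x : J × κ, linImage (fun x : J × κ => u x.1 x.2) g x ∂(_root_.stdGaussian E)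
      ≤ M + Real.log (Fintype.card J) / t + t * σ ^ 2 + Real.log (Fintype.card κ) / β := by
  set c := Real.log (Fintype.card J) + (t * (M + Real.log (Fintype.card κ) / β) + t ^ 2 * σ ^ 2)
    with hc
  have hI := integrable_ciSup_linImage (E := E) (fun x : J × κ => u x.1 x.2)
  have hS : Integrable (fun g => ∑ j, Real.exp (t * softMax β (linImage (u j) g)))
      (_root_.stdGaussian E) :=
    integrable_finsetSum _ fun j _ => integrable_exp_mul_softMax hβ t (u j)
  have h1 : ∀ g, t * (⨆ x : J × κ, linImage (fun x : J × κ => u x.1 x.2) g x)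
      ≤ Real.exp (-c) * (∑ j, Real.exp (t * softMax β (linImage (u j) g))) + (c - 1) := fun g => by
    obtain ⟨x, hx⟩ := exists_eq_ciSup_of_finite
      (f := fun x : J × κ => linImage (fun x : J × κ => u x.1 x.2) g x)
    rw [← hx]
    have h2 : linImage (fun x : J × κ => u x.1 x.2) g x ≤ softMax β (linImage (u x.1) g) :=
      le_softMax hβ (linImage (u x.1) g) x.2
    have h3 := Finset.single_le_sum (f := fun j => Real.exp (t * softMax β (linImage (u j) g)))
      (fun _ _ => (Real.exp_pos _).le) (Finset.mem_univ x.1)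
    have h4 := Real.add_one_le_exp (t * softMax β (linImage (u x.1) g) - c)
    rw [sub_eq_neg_add, Real.exp_add] at h4
    have h5 := mul_le_mul_of_nonneg_left h3 (Real.exp_pos (-c)).le
    have h6 := mul_le_mul_of_nonneg_left h2 ht.le
    linarith
  have h2 := integral_mono (hI.const_mul t) ((hS.const_mul _).add (integrable_const _)) h1
  rw [integral_const_mul, integral_add' (hS.const_mul _) (integrable_const _), integral_const_mul,
    integral_finsetSum _ fun j _ => integrable_exp_mul_softMax hβ t (u j)] at h2
  have hJ : (0 : ℝ) < Fintype.card J := by exact_mod_cast Fintype.card_pos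
  have h3 : ∑ j, ∫ g, Real.exp (t * softMax β (linImage (u j) g)) ∂(_root_.stdGaussian E)
      ≤ Real.exp c := by
    calc _ ≤ ∑ _j : J, Real.exp (t * (M + Real.log (Fintype.card κ) / β) + t ^ 2 * σ ^ 2) := by
          refine Finset.sum_le_sum fun j _ =>
            (integral_exp_mul_softMax_le hβ ht.le (hu j)).trans (Real.exp_le_exp.2 ?_)
          have := (integral_softMax_le_integral_ciSup hβ (u j)).trans
            (add_le_add_left (hM j) _)
          nlinarith
      _ = Real.exp c := by rw [hc, Real.exp_add (Real.log _), Real.exp_log hJ]; simp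
  have h4 := mul_le_mul_of_nonneg_left h3 (Real.exp_pos (-c)).le
  rw [← Real.exp_add, neg_add_cancel, Real.exp_zero] at h4
  simp only [integral_const, probReal_univ, smul_eq_mul, one_mul] at h2
  have h5 : t * (∫ g, ⨆ x : J × κ, linImage (fun x : J × κ => u x.1 x.2) g x
      ∂(_root_.stdGaussian E)) ≤ c := by linarith
  rw [mul_comm, ← le_div_iff₀ ht] at h5
  refine h5.trans (le_of_eq ?_)
  rw [hc]; field_simp; ring

/-- The expected maximum of finitely many Gaussian suprema. -/
lemma integral_ciSup_prod_le {u : J → κ → E → ℝ} {σ M L : ℝ} (hσ : 0 ≤ σ) (hL : 0 < L)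
    (hJ : Real.log (Fintype.card J) ≤ L) (hu : ∀ j k, ∑ e, u j k e ^ 2 ≤ σ ^ 2)
    (hM : ∀ j, ∫ g, ⨆ k, linImage (u j) g k ∂(_root_.stdGaussian E) ≤ M) :
    ∫ g, ⨆ x : J × κ, linImage (fun x : J × κ => u x.1 x.2) g x ∂(_root_.stdGaussian E)
      ≤ M + 2 * σ * Real.sqrt L := by
  have h : ∀ t, 0 < t →
      ∫ g, ⨆ x : J × κ, linImage (fun x : J × κ => u x.1 x.2) g x ∂(_root_.stdGaussian E)
      ≤ M + L / t + t * σ ^ 2 := fun t ht => by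
    have h1 := le_of_forall_le_add_div log_card_nonneg
      fun β hβ => integral_ciSup_prod_le_of_pos hβ ht hu hM
    have : Real.log (Fintype.card J) / t ≤ L / t := div_le_div_of_nonneg_right hJ ht.le
    linarith
  rcases hσ.eq_or_lt with rfl | hσ
  · refine le_of_forall_le_add_div hL.le fun t ht => ?_
    have := h t ht
    simp only [mul_zero, zero_mul, add_zero]
    nlinarith
  · have hs := Real.sqrt_pos.2 hL
    refine (h (Real.sqrt L / σ) (by positivity)).trans (le_of_eq ?_)
    have : L = Real.sqrt L ^ 2 := (Real.sq_sqrt hL.le).symm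
    field_simp
    nlinarith

end

section

lemma exists_dyadic_approx (K : ℕ) {x : ℝ} (hx : x ≤ 1) :
    ∃ k : ℕ, k ≤ K ∧ x ≤ 2 * (1 / 2) ^ k ∧ ((1 / 2 : ℝ) ^ k ≤ x ∨ k = K) := by
  induction K with
  | zero => exact ⟨0, le_rfl, by norm_num; linarith, Or.inr rfl⟩
  | succ K ih =>
    obtain ⟨k, hk, h1, h2⟩ := ih
    by_cases h3 : (1 / 2 : ℝ) ^ k ≤ x
    · exact ⟨k, hk.trans (Nat.le_succ K), h1, Or.inl h3⟩
    · have h4 := h2.resolve_left h3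
      subst h4
      refine ⟨k + 1, le_rfl, ?_, Or.inr rfl⟩
      rw [pow_succ]; linarith

lemma card_filter_ne_none_le {N V : Type*} [Fintype N] [Nonempty N] [DecidableEq N] [Fintype V]
    [DecidableEq V] (M : ℕ) :
    (Finset.univ.filter fun c : N → Option V =>
      (Finset.univ.filter fun j => c j ≠ none).card ≤ M).card
      ≤ (Fintype.card N * (Fintype.card V + 1)) ^ M := by
  induction M with
  | zero =>
    rw [pow_zero, Finset.card_le_one]
    intro c hc c' hc'
    simp only [Finset.mem_filter, Finset.mem_univ, true_and, nonpos_iff_eq_zero,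
      Finset.card_eq_zero, Finset.filter_eq_empty_iff, not_not] at hc hc'
    ext j
    rw [hc trivial, hc' trivial]
  | succ M ih =>
    have hsub : (Finset.univ.filter fun c : N → Option V =>
        (Finset.univ.filter fun j => c j ≠ none).card ≤ M + 1)
        ⊆ ((Finset.univ.filter fun c : N → Option V =>
        (Finset.univ.filter fun j => c j ≠ none).card ≤ M) ×ˢ
          (Finset.univ : Finset (N × Option V))).image
            fun x => Function.update x.1 x.2.1 x.2.2 := by
      intro c hc
      simp only [Finset.mem_filter, Finset.mem_univ, true_and] at hc
      rw [Finset.mem_image]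
      by_cases h : ∃ j, c j ≠ none
      · obtain ⟨j, hj⟩ := h
        refine ⟨(Function.update c j none, (j, c j)), ?_, by simp⟩
        simp only [Finset.mem_product, Finset.mem_filter, Finset.mem_univ, true_and, and_true]
        have : (Finset.univ.filter fun i => Function.update c j none i ≠ none)
            = (Finset.univ.filter fun i => c i ≠ none).erase j := by
          ext i
          by_cases hij : i = j
          · subst hij; simp
          · simp [hij]
        rw [this, Finset.card_erase_of_mem (by simpa using hj)]
        omega
      · push Not at h
        refine ⟨(c, (Classical.arbitrary N, none)), ?_, ?_⟩
        · simp [h]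
        · ext i; simp [Function.update_apply, h]
    refine (Finset.card_le_card hsub).trans (Finset.card_image_le.trans ?_)
    rw [Finset.card_product, pow_succ]
    refine Nat.mul_le_mul ih ?_
    simp [Fintype.card_prod]

/-- A finite half-net of the Euclidean unit ball computes the Euclidean norm up to a factor 2. -/
lemma exists_finset_sqrt_sum_sq_le (ι : Type*) [Fintype ι] :
    ∃ W : Finset (ι → ℝ), W.Nonempty ∧ (∀ w ∈ W, ∑ i, w i ^ 2 ≤ 1) ∧
      ∀ x : ι → ℝ, ∃ w ∈ W, Real.sqrt (∑ i, x i ^ 2) ≤ 2 * ∑ i, w i * x i := by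
  classical
  obtain ⟨t, ht, htf, hcov⟩ := (isCompact_closedBall (0 : EuclideanSpace ℝ ι) 1).finite_cover_balls
    (e := 1 / 2) (by norm_num)
  have hnet : ∀ y : EuclideanSpace ℝ ι, ‖y‖ ≤ 1 → ∃ w ∈ t, ‖y - w‖ ≤ 1 / 2 := fun y hy => by
    have := hcov (by simpa using hy : y ∈ Metric.closedBall 0 1)
    simp only [Set.mem_iUnion, Metric.mem_ball, dist_eq_norm] at this
    obtain ⟨w, hw, h⟩ := this
    exact ⟨w, hw, h.le⟩
  have key : ∀ x : EuclideanSpace ℝ ι, ∃ w ∈ t, ‖x‖ ≤ 2 * inner ℝ x w := fun x => by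
    by_cases hx : x = 0
    · obtain ⟨w, hw, -⟩ := hnet 0 (by simp)
      exact ⟨w, hw, by simp [hx]⟩
    · have hx0 := norm_pos_iff.2 hx
      obtain ⟨w, hw, h⟩ := hnet (‖x‖⁻¹ • x) (by rw [norm_smul]; simp [hx0.ne'])
      refine ⟨w, hw, ?_⟩
      have h1 : inner ℝ x (‖x‖⁻¹ • x) = ‖x‖ := by
        rw [real_inner_smul_right, real_inner_self_eq_norm_sq]; field_simp
      have h2 := (real_inner_le_norm x (‖x‖⁻¹ • x - w)).trans
        (mul_le_mul_of_nonneg_left h hx0.le)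
      rw [inner_sub_right, h1] at h2
      linarith
  refine ⟨htf.toFinset.image fun w i => w i, ?_, ?_, fun x => ?_⟩
  · obtain ⟨w, hw, -⟩ := key 0
    exact ⟨_, Finset.mem_image_of_mem _ (htf.mem_toFinset.2 hw)⟩
  · intro w hw
    obtain ⟨y, hy, rfl⟩ := Finset.mem_image.1 hw
    have h1 : ‖y‖ ≤ 1 := by simpa using ht (htf.mem_toFinset.1 hy)
    rw [EuclideanSpace.norm_eq, Real.sqrt_le_one] at h1
    simpa using h1
  · obtain ⟨w, hw, h⟩ := key (WithLp.toLp 2 x)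
    refine ⟨_, Finset.mem_image_of_mem _ (htf.mem_toFinset.2 hw), ?_⟩
    simpa [EuclideanSpace.norm_eq, PiLp.inner_apply] using h

/-- Gaussian absolute moments. -/
lemma integral_abs_rpow_gaussianReal_le {q : ℝ} (hq : 1 ≤ q) :
    Integrable (fun x : ℝ => |x| ^ q) (gaussianReal 0 1) ∧
    ∫ x, |x| ^ q ∂(gaussianReal 0 1) ≤ (Real.exp 2 * Real.sqrt q) ^ q := by
  have hq0 : 0 < q := by linarith
  set s := Real.sqrt q with hs
  have hs0 : 0 < s := Real.sqrt_pos.2 hq0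
  have hss : s * s = q := Real.mul_self_sqrt hq0.le
  have hb : ∀ x : ℝ, |x| ^ q ≤ s ^ q * (Real.exp (s * x) + Real.exp (-s * x)) := fun x => by
    have h1 : |x| ≤ s * Real.exp (|x| / s) := by
      have := Real.add_one_le_exp (|x| / s)
      have h2 : |x| = s * (|x| / s) := by field_simp
      nlinarith
    calc |x| ^ q ≤ (s * Real.exp (|x| / s)) ^ q := by gcongr
      _ = s ^ q * Real.exp (s * |x|) := by
          rw [Real.mul_rpow hs0.le (Real.exp_pos _).le, ← Real.exp_mul, ← hss]
          congr 2; field_simp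
      _ ≤ _ := by
          refine mul_le_mul_of_nonneg_left ?_ (by positivity)
          rcases abs_cases x with ⟨h, -⟩ | ⟨h, -⟩ <;> rw [h]
          · linarith [Real.exp_pos (-s * x)]
          · rw [mul_neg, ← neg_mul]; linarith [Real.exp_pos (s * x)]
  have hi : ∀ t : ℝ, Integrable (fun x => Real.exp (t * x)) (gaussianReal 0 1) := fun t =>
    integrable_exp_mul_gaussianReal t
  have hI : Integrable (fun x => s ^ q * (Real.exp (s * x) + Real.exp (-s * x)))
      (gaussianReal 0 1) := ((hi s).add (hi (-s))).const_mul _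
  have hm : ∀ t : ℝ, ∫ x, Real.exp (t * x) ∂(gaussianReal 0 1) = Real.exp (t ^ 2 / 2) := fun t => by
    have := congrFun (mgf_id_gaussianReal (μ := 0) (v := 1)) t
    simpa [mgf] using this
  have hint : Integrable (fun x : ℝ => |x| ^ q) (gaussianReal 0 1) :=
    hI.mono' (continuous_abs.rpow_const fun _ => Or.inr hq0.le).aestronglyMeasurable
      (Filter.Eventually.of_forall fun x => by
        rw [Real.norm_of_nonneg (by positivity)]; exact hb x)
  refine ⟨hint, (integral_mono hint hI hb).trans ?_⟩
  rw [integral_const_mul, integral_add (hi s) (hi (-s)), hm, hm,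
    Real.mul_rpow (Real.exp_pos _).le hs0.le, mul_comm]
  refine mul_le_mul_of_nonneg_right ?_ (by positivity)
  rw [neg_sq, ← two_mul, sq, hss, ← Real.exp_mul]
  have h2 : (2 : ℝ) ≤ Real.exp q := by linarith [Real.add_one_le_exp q]
  calc 2 * Real.exp (q / 2) ≤ Real.exp q * Real.exp (q / 2) := by gcongr
    _ = Real.exp (q + q / 2) := (Real.exp_add _ _).symm
    _ ≤ Real.exp (2 * q) := Real.exp_le_exp.2 (by linarith)

end

section LpNorm

variable {ι : Type*} [Fintype ι]

lemma sum_rpow_le_of_lpNorm_le {r : ℝ≥0∞} (hr : r ≠ ⊤) (hr0 : r ≠ 0) {x : ι → ℝ} {c : ℝ}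
    (h : _root_.lpNorm r x ≤ c) : ∑ i, |x i| ^ r.toReal ≤ c ^ r.toReal := by
  have hr1 : 0 < r.toReal := ENNReal.toReal_pos hr0 hr
  rw [_root_.lpNorm, if_neg hr] at h
  have h0 : 0 ≤ ∑ i, |x i| ^ r.toReal := by positivity
  calc ∑ i, |x i| ^ r.toReal = ((∑ i, |x i| ^ r.toReal) ^ (1 / r.toReal)) ^ r.toReal := by
        rw [← Real.rpow_mul h0, one_div_mul_cancel hr1.ne', Real.rpow_one]
    _ ≤ c ^ r.toReal := Real.rpow_le_rpow (by positivity) h hr1.le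

lemma lpNorm_nonneg' (r : ℝ≥0∞) (x : ι → ℝ) : 0 ≤ _root_.lpNorm r x := by
  rw [_root_.lpNorm]
  split_ifs
  · exact Real.iSup_nonneg fun i => abs_nonneg _
  · positivity

lemma abs_le_lpNorm {r : ℝ≥0∞} (hr0 : r ≠ 0) (x : ι → ℝ) (i : ι) :
    |x i| ≤ _root_.lpNorm r x := by
  by_cases hr : r = ⊤
  · rw [_root_.lpNorm, if_pos hr]
    exact le_ciSup_finite (fun i => |x i|) i
  · have hr1 : 0 < r.toReal := ENNReal.toReal_pos hr0 hr
    have h := sum_rpow_le_of_lpNorm_le hr hr0 (le_refl (_root_.lpNorm r x))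
    have h1 := (Finset.single_le_sum (f := fun i => |x i| ^ r.toReal) (fun _ _ => by positivity)
      (Finset.mem_univ i)).trans h
    exact (Real.rpow_le_rpow_iff (abs_nonneg _) (lpNorm_nonneg' r x) hr1).1 h1

/-- Hölder-type bound for weighted sums of small coordinates. -/
lemma sum_sq_mul_sq_le {p pstar : ℝ≥0∞} (hp : 1 / p + 1 / pstar = 1) (h2 : 2 ≤ pstar)
    {x τ : ι → ℝ} {D δ : ℝ} (hx : _root_.lpNorm pstar x ≤ D) (hδ : 0 ≤ δ)
    (hτ : ∀ j, |τ j| ≤ δ) (hs : ∑ j, |τ j| ^ p.toReal ≤ 2) :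
    ∑ j, x j ^ 2 * τ j ^ 2 ≤ 3 * D ^ 2 * δ ^ p.toReal := by
  have hD := (lpNorm_nonneg' pstar x).trans hx
  have hps0 : pstar ≠ 0 := fun h => by simp [h] at h2
  by_cases htop : pstar = ⊤
  · have hp1 : p = 1 := by simpa [htop] using hp
    subst hp1
    simp only [ENNReal.toReal_one, Real.rpow_one] at *
    calc ∑ j, x j ^ 2 * τ j ^ 2 ≤ ∑ j, D ^ 2 * (δ * |τ j|) := by
          refine Finset.sum_le_sum fun j _ => ?_
          have h3 := (abs_le_lpNorm hps0 x j).trans hx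
          rw [← sq_abs (x j), ← sq_abs (τ j)]
          have := hτ j
          have h4 : |τ j| ^ 2 ≤ δ * |τ j| := by nlinarith [abs_nonneg (τ j)]
          gcongr
      _ = D ^ 2 * δ * ∑ j, |τ j| := by rw [Finset.mul_sum]; simp [mul_assoc]
      _ ≤ D ^ 2 * δ * 2 := by gcongr
      _ ≤ 3 * D ^ 2 * δ := by nlinarith [mul_nonneg (sq_nonneg D) hδ]
  · have hptop : p ≠ ⊤ := by
      rintro rfl
      simp only [one_div, ENNReal.inv_top, zero_add, ENNReal.inv_eq_one] at hp
      rw [hp] at h2; norm_num at h2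
    have hp0 : p ≠ 0 := by
      rintro rfl
      simp at hp
    have hr : 1 / p.toReal + 1 / pstar.toReal = 1 := by
      have := congrArg ENNReal.toReal hp
      rw [ENNReal.toReal_add (by simp [hp0]) (by simp [hps0])] at this
      simpa using this
    have hp1 : 0 < p.toReal := ENNReal.toReal_pos hp0 hptop
    have hq2 : 2 ≤ pstar.toReal := by
      simpa using ENNReal.toReal_mono htop h2
    set P := p.toReal
    set Q := pstar.toReal
    have hQ : 0 < Q := by linarith
    rcases hD.eq_or_lt with hD0 | hD0
    · have : ∀ j, x j = 0 := fun j => by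
        have := (abs_le_lpNorm hps0 x j).trans hx
        rw [← hD0] at this
        exact abs_nonpos_iff.1 this
      simp [this, ← hD0]
    · have hsum : ∑ j, (|x j| / D) ^ Q ≤ 1 := by
        have := sum_rpow_le_of_lpNorm_le htop hps0 hx
        simp_rw [Real.div_rpow (abs_nonneg _) hD]
        rw [← Finset.sum_div]
        exact div_le_one_of_le₀ this (by positivity)
      have hw : 2 / Q ≤ 1 := by rw [div_le_one hQ]; exact hq2
      have hterm : ∀ j, x j ^ 2 * τ j ^ 2
          ≤ D ^ 2 * δ ^ P * ((|x j| / D) ^ Q + |τ j| ^ P) := fun j => by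
        set y := |x j| / D
        have hy : 0 ≤ y := by positivity
        have hxy : x j ^ 2 = D ^ 2 * y ^ 2 := by
          rw [← sq_abs]; simp only [y]; field_simp
        have ht := abs_nonneg (τ j)
        have h3 := Real.geom_mean_le_arith_mean2_weighted (w₁ := 2 / Q) (w₂ := 1 - 2 / Q)
          (p₁ := y ^ Q) (p₂ := |τ j| ^ P) (by positivity) (by linarith) (by positivity)
          (by positivity) (by ring)
        rw [← Real.rpow_mul hy, ← Real.rpow_mul ht, mul_div_cancel₀ _ hQ.ne'] at h3
        have h4 : P * (1 - 2 / Q) = 2 - P := by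
          have : 2 / Q = 2 - 2 / P := by
            have h1 : 2 / Q = 2 * (1 / Q) := by ring
            have h2 : 2 / P = 2 * (1 / P) := by ring
            linarith
          rw [this]; field_simp; ring
        have h5 : 2 / Q * y ^ Q + (1 - 2 / Q) * |τ j| ^ P ≤ y ^ Q + |τ j| ^ P := by
          have : 0 ≤ 2 / Q := by positivity
          nlinarith [Real.rpow_nonneg hy Q, Real.rpow_nonneg ht P]
        have h6 : |τ j| ^ 2 = |τ j| ^ (2 - P) * |τ j| ^ P := by
          rw [← Real.rpow_add_of_nonneg ht (by nlinarith) hp1.le]; simp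
        have h7 : |τ j| ^ P ≤ δ ^ P := Real.rpow_le_rpow ht (hτ j) hp1.le
        rw [h4] at h3
        rw [hxy, ← sq_abs (τ j), h6]
        have h8 : y ^ 2 * |τ j| ^ (2 - P) ≤ y ^ Q + |τ j| ^ P := by
          have := h3.trans h5
          simpa using this
        calc D ^ 2 * y ^ 2 * (|τ j| ^ (2 - P) * |τ j| ^ P)
            = D ^ 2 * |τ j| ^ P * (y ^ 2 * |τ j| ^ (2 - P)) := by ring
          _ ≤ D ^ 2 * δ ^ P * (y ^ Q + |τ j| ^ P) := by gcongr
      calc ∑ j, x j ^ 2 * τ j ^ 2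
          ≤ ∑ j, D ^ 2 * δ ^ P * ((|x j| / D) ^ Q + |τ j| ^ P) :=
            Finset.sum_le_sum fun j _ => hterm j
        _ = D ^ 2 * δ ^ P * (∑ j, (|x j| / D) ^ Q + ∑ j, |τ j| ^ P) := by
            rw [← Finset.sum_add_distrib, Finset.mul_sum]
        _ ≤ D ^ 2 * δ ^ P * (1 + 2) := by gcongr
        _ = 3 * D ^ 2 * δ ^ P := by ring

end LpNorm

section

lemma integral_comp_eval_stdGaussian {E : Type*} [Fintype E] (e : E) {f : ℝ → ℝ}
    (hf : Continuous f) :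
    ∫ g, f (g e) ∂(_root_.stdGaussian E) = ∫ x, f x ∂(gaussianReal 0 1) := by
  have h : MeasurePreserving (Function.eval e) (_root_.stdGaussian E) (gaussianReal 0 1) :=
    measurePreserving_eval (fun _ : E => gaussianReal 0 1) e
  rw [← h.map_eq, integral_map h.measurable.aemeasurable hf.aestronglyMeasurable]

lemma integral_eval_stdGaussian {E : Type*} [Fintype E] (e : E) :
    ∫ g, g e ∂(_root_.stdGaussian E) = 0 := by
  rw [integral_comp_eval_stdGaussian e (f := fun x => x) continuous_id]
  exact integral_id_gaussianReal

end

section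

variable {I N S T F : Type*} [Fintype I] [Fintype N] [Fintype S] [Nonempty S] [Fintype T]
  [Nonempty T] [Fintype F]

lemma sum_sq_sub_le (a : N → ℝ) (s s' : ℝ) (t t' : N → ℝ) {Δ : ℝ}
    (hΔ : ∑ j, a j ^ 2 * (t j - t' j) ^ 2 ≤ Δ) :
    ∑ j, (a j * s * t j - a j * s' * t' j) ^ 2
      ≤ (s * Real.sqrt (∑ j, a j ^ 2 * t j ^ 2) - s' * Real.sqrt (∑ j, a j ^ 2 * t' j ^ 2)) ^ 2
        + (s ^ 2 + s' ^ 2) / 2 * Δ := by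
  set P := ∑ j, a j ^ 2 * t j ^ 2
  set Q := ∑ j, a j ^ 2 * t' j ^ 2
  set R := ∑ j, (a j * t j) * (a j * t' j)
  have hP : 0 ≤ P := by positivity
  have hQ : 0 ≤ Q := by positivity
  have sP := Real.sq_sqrt hP
  have sQ := Real.sq_sqrt hQ
  have e1 : ∑ j, (a j * s * t j - a j * s' * t' j) ^ 2
      = s ^ 2 * P + s' ^ 2 * Q - 2 * (s * s') * R := by
    simp only [P, Q, R, Finset.mul_sum]
    rw [← Finset.sum_add_distrib, ← Finset.sum_sub_distrib]
    exact Finset.sum_congr rfl fun j _ => by ring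
  have e2 : ∑ j, a j ^ 2 * (t j - t' j) ^ 2 = P + Q - 2 * R := by
    simp only [P, Q, R, Finset.mul_sum]
    rw [← Finset.sum_add_distrib, ← Finset.sum_sub_distrib]
    exact Finset.sum_congr rfl fun j _ => by ring
  have hR : R ≤ Real.sqrt P * Real.sqrt Q := by
    have := Real.sum_mul_le_sqrt_mul_sqrt Finset.univ (fun j => a j * t j) (fun j => a j * t' j)
    simpa only [mul_pow] using this
  rw [e2] at hΔ
  rw [e1]
  set x := Real.sqrt P
  set y := Real.sqrt Q
  have h1 : 2 * (x * y - R) ≤ Δ := by nlinarith [sq_nonneg (x - y)]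
  have h2 : 2 * (s * s') * (x * y - R) ≤ (s ^ 2 + s' ^ 2) * (x * y - R) := by
    refine mul_le_mul_of_nonneg_right ?_ (by linarith)
    nlinarith [sq_nonneg (s - s')]
  have h3 : (s ^ 2 + s' ^ 2) / 2 * (2 * (x * y - R)) ≤ (s ^ 2 + s' ^ 2) / 2 * Δ :=
    mul_le_mul_of_nonneg_left h1 (by positivity)
  nlinarith

/-- Comparison of a Gaussian bilinear form with a sum of two independent processes. -/
lemma integral_ciSup_bilinear_le (A : I → N → ℝ) (s : S → I → ℝ) (t : T → N → ℝ) (z : T → F → ℝ)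
    {b : ℝ} (hb : 0 ≤ b) (hs : ∀ x, ∑ i, s x i ^ 2 ≤ b ^ 2)
    (hz : ∀ y y' i, ∑ j, A i j ^ 2 * (t y j - t y' j) ^ 2 ≤ ∑ f, (z y f - z y' f) ^ 2) :
    ∫ g, ⨆ x : S × T, linImage (fun (x : S × T) (e : I × N) =>
        A e.1 e.2 * s x.1 e.1 * t x.2 e.2) g x ∂(_root_.stdGaussian (I × N))
      ≤ (∫ g, ⨆ x : S × T, linImage (fun (x : S × T) (i : I) =>
          s x.1 i * Real.sqrt (∑ j, A i j ^ 2 * t x.2 j ^ 2)) g x ∂(_root_.stdGaussian I))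
        + b * ∫ g, ⨆ y, linImage z g y ∂(_root_.stdGaussian F) := by
  set w : S × T → I → ℝ := fun x i => s x.1 i * Real.sqrt (∑ j, A i j ^ 2 * t x.2 j ^ 2) with hw
  have h1 := integral_ciSup_linImage_le (u := fun (x : S × T) (e : I × N) =>
      A e.1 e.2 * s x.1 e.1 * t x.2 e.2)
    (v := fun x : S × T => Sum.elim (w x) (fun f => b * z x.2 f)) (fun x x' => by
      rw [Fintype.sum_prod_type, Fintype.sum_sum_type]
      simp only [Sum.elim_inl, Sum.elim_inr, hw]
      set Δ := ∑ f, (z x.2 f - z x'.2 f) ^ 2 with hΔ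
      have e : ∑ f, (b * z x.2 f - b * z x'.2 f) ^ 2 = b ^ 2 * Δ := by
        rw [hΔ, Finset.mul_sum]
        exact Finset.sum_congr rfl fun f _ => by ring
      have hΔ0 : 0 ≤ Δ := by positivity
      refine (Finset.sum_le_sum fun i _ => sum_sq_sub_le (A i) (s x.1 i) (s x'.1 i) (t x.2)
        (t x'.2) (hz x.2 x'.2 i)).trans ?_
      rw [Finset.sum_add_distrib, e]
      refine add_le_add le_rfl ?_
      rw [← Finset.sum_mul, ← Finset.sum_div, Finset.sum_add_distrib]
      refine mul_le_mul_of_nonneg_right ?_ hΔ0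
      linarith [hs x.1, hs x'.1])
  have cl : Continuous fun g : I ⊕ F → ℝ => g ∘ Sum.inl := by fun_prop
  have cr : Continuous fun g : I ⊕ F → ℝ => g ∘ Sum.inr := by fun_prop
  have c1 : Continuous fun g : I → ℝ => ⨆ x, linImage w g x :=
    continuous_ciSup_apply.comp (continuous_linImage w)
  have c2 : Continuous fun g : F → ℝ => ⨆ y, linImage z g y :=
    continuous_ciSup_apply.comp (continuous_linImage z)
  have i1 : Integrable (fun g : I ⊕ F → ℝ => ⨆ x, linImage w (g ∘ Sum.inl) x)
      (_root_.stdGaussian (I ⊕ F)) :=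
    (measurePreserving_comp_inl (E₁ := I) (E₂ := F)).integrable_comp_of_integrable
      (integrable_ciSup_linImage w)
  have i2 : Integrable (fun g : I ⊕ F → ℝ => ⨆ y, linImage z (g ∘ Sum.inr) y)
      (_root_.stdGaussian (I ⊕ F)) :=
    (measurePreserving_comp_inr (E₁ := I) (E₂ := F)).integrable_comp_of_integrable
      (integrable_ciSup_linImage z)
  refine h1.trans ?_
  rw [← integral_comp_inl (E₂ := F) c1, ← integral_comp_inr (E₁ := I) c2, ← integral_const_mul,
    ← integral_add i1 (i2.const_mul b)]
  refine integral_mono (integrable_ciSup_linImage _) (i1.add (i2.const_mul b)) fun g => ?_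
  refine ciSup_le fun x => ?_
  have e : linImage (fun x : S × T => Sum.elim (w x) (fun f => b * z x.2 f)) g x
      = linImage w (g ∘ Sum.inl) x + b * linImage z (g ∘ Sum.inr) x.2 := by
    simp [linImage, Fintype.sum_sum_type, Finset.mul_sum, mul_assoc]
  rw [e]
  exact add_le_add (le_ciSup_finite _ x) (mul_le_mul_of_nonneg_left (le_ciSup_finite _ x.2) hb)

end

section Dyadic

variable {N : Type*} [Fintype N] {K : ℕ}

/-- The signed dyadic number encoded by a level and a sign. -/
def dyadicVal (c : Fin (K + 1) × Bool) : ℝ :=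
  (if c.2 then 1 else -1) * (1 / 2) ^ (c.1 : ℕ)

lemma abs_dyadicVal (c : Fin (K + 1) × Bool) : |dyadicVal c| = (1 / 2) ^ (c.1 : ℕ) := by
  rw [dyadicVal, abs_mul, abs_of_pos (by positivity : (0 : ℝ) < (1 / 2) ^ (c.1 : ℕ))]
  split_ifs <;> simp

/-- Forget the coordinates beyond a given level. -/
def dyadicTrunc (l : Fin (K + 1)) (c : N → Fin (K + 1) × Bool) (j : N) :
    Option (Fin (K + 1) × Bool) :=
  if (c j).1 ≤ l then some (c j) else none

/-- Codes of dyadic vectors in a multiple of the `ℓ_p` ball. -/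
abbrev DyadicCode (N : Type*) [Fintype N] (K : ℕ) (P : ℝ) : Type _ :=
  {c : N → Fin (K + 1) × Bool // ∑ j, |dyadicVal (c j)| ^ P ≤ 2}

/-- Coefficients of the multiscale Gaussian process indexed by dyadic codes. -/
def dyadicProcess [DecidableEq N] (P D : ℝ) (c : DyadicCode N K P)
    (f : Fin (K + 1) × (N → Option (Fin (K + 1) × Bool))) : ℝ :=
  if f.2 = dyadicTrunc f.1 c.1 then Real.sqrt (6 * D ^ 2 * ((1 / 2) ^ (f.1 : ℕ)) ^ P) else 0

lemma exists_level_of_ne {c c' : N → Fin (K + 1) × Bool} (h : c ≠ c') :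
    ∃ l, dyadicTrunc l c ≠ dyadicTrunc l c' ∧
      ∀ j, c j ≠ c' j → l ≤ (c j).1 ∧ l ≤ (c' j).1 := by
  classical
  have hlast : dyadicTrunc (Fin.last K) c ≠ dyadicTrunc (Fin.last K) c' := by
    intro h'
    refine h (funext fun j => ?_)
    have := congrFun h' j
    simpa [dyadicTrunc, Fin.le_last] using this
  obtain ⟨l, hl, hmin⟩ := Finset.exists_min_image
    (Finset.univ.filter fun l => dyadicTrunc l c ≠ dyadicTrunc l c') id
    ⟨Fin.last K, by simpa using hlast⟩
  have hlt : ∀ k < l, dyadicTrunc k c = dyadicTrunc k c' := fun k hk => by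
    by_contra hne
    exact absurd (hmin k (by simpa using hne)) (not_le.2 hk)
  refine ⟨l, by simpa using hl, fun j hj => ⟨?_, ?_⟩⟩
  · by_contra hlj
    have := congrFun (hlt _ (not_le.1 hlj)) j
    simp only [dyadicTrunc, le_refl, if_true] at this
    split_ifs at this with h1
    exact hj (Option.some.inj this)
  · by_contra hlj
    have := congrFun (hlt _ (not_le.1 hlj)) j
    simp only [dyadicTrunc, le_refl, if_true] at this
    split_ifs at this with h1
    exact hj (Option.some.inj this)

lemma sum_sq_sub_le_dyadicProcess [DecidableEq N] {P D : ℝ} (hP : 0 < P) {x : N → ℝ}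
    (hx : ∀ (δ : ℝ) (τ : N → ℝ), 0 ≤ δ → (∀ j, |τ j| ≤ δ) → ∑ j, |τ j| ^ P ≤ 2 →
      ∑ j, x j ^ 2 * τ j ^ 2 ≤ 3 * D ^ 2 * δ ^ P) (c c' : DyadicCode N K P) :
    ∑ j, x j ^ 2 * (dyadicVal (c.1 j) - dyadicVal (c'.1 j)) ^ 2
      ≤ ∑ f, (dyadicProcess P D c f - dyadicProcess P D c' f) ^ 2 := by
  by_cases hcc : c.1 = c'.1
  · simp only [hcc, sub_self]
    simpa using Finset.sum_nonneg fun f _ =>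
      sq_nonneg (dyadicProcess P D c f - dyadicProcess P D c' f)
  obtain ⟨l, hl, hlev⟩ := exists_level_of_ne hcc
  set δ : ℝ := (1 / 2) ^ (l : ℕ) with hδ
  have hδ0 : 0 < δ := by positivity
  set τ : DyadicCode N K P → N → ℝ := fun c j => if l ≤ (c.1 j).1 then dyadicVal (c.1 j) else 0
    with hτ
  have hτb : ∀ c, ∑ j, x j ^ 2 * τ c j ^ 2 ≤ 3 * D ^ 2 * δ ^ P := fun c => by
    refine hx δ (τ c) hδ0.le (fun j => ?_) (le_trans (Finset.sum_le_sum fun j _ => ?_) c.2)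
    · simp only [hτ]
      split_ifs with h
      · rw [abs_dyadicVal]
        exact pow_le_pow_of_le_one (by norm_num) (by norm_num) h
      · simpa using hδ0.le
    · simp only [hτ]
      split_ifs with h
      · exact le_rfl
      · rw [abs_zero, Real.zero_rpow hP.ne']
        exact Real.rpow_nonneg (abs_nonneg _) _
  have h1 : ∑ j, x j ^ 2 * (dyadicVal (c.1 j) - dyadicVal (c'.1 j)) ^ 2
      ≤ 12 * D ^ 2 * δ ^ P := by
    calc _ ≤ ∑ j, (2 * (x j ^ 2 * τ c j ^ 2) + 2 * (x j ^ 2 * τ c' j ^ 2)) := by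
          refine Finset.sum_le_sum fun j _ => ?_
          by_cases hj : c.1 j = c'.1 j
          · have h3 : 0 ≤ x j ^ 2 * τ c j ^ 2 := by positivity
            have h4 : 0 ≤ x j ^ 2 * τ c' j ^ 2 := by positivity
            rw [hj, sub_self]
            linarith
          · obtain ⟨h1, h2⟩ := hlev j hj
            simp only [hτ, h1, h2, if_true]
            nlinarith [mul_nonneg (sq_nonneg (x j))
              (sq_nonneg (dyadicVal (c.1 j) + dyadicVal (c'.1 j)))]
      _ ≤ _ := by
          rw [Finset.sum_add_distrib, ← Finset.mul_sum, ← Finset.mul_sum]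
          linarith [hτb c, hτb c']
  refine h1.trans ?_
  have hne : ((l, dyadicTrunc l c.1) : Fin (K + 1) × (N → Option (Fin (K + 1) × Bool)))
      ≠ (l, dyadicTrunc l c'.1) := fun h => hl (Prod.ext_iff.1 h).2
  have h2 := Finset.sum_le_univ_sum_of_nonneg
    (s := {((l, dyadicTrunc l c.1) : Fin (K + 1) × (N → Option (Fin (K + 1) × Bool))),
      (l, dyadicTrunc l c'.1)})
    (f := fun f => (dyadicProcess P D c f - dyadicProcess P D c' f) ^ 2) fun f => sq_nonneg _
  refine le_trans (le_of_eq ?_) h2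
  rw [Finset.sum_pair hne]
  have h6 : 0 ≤ 6 * D ^ 2 * δ ^ P := by positivity
  simp only [dyadicProcess, if_true, if_neg hl, if_neg (Ne.symm hl), sub_zero, zero_sub, neg_sq]
  rw [Real.sq_sqrt h6]
  ring

lemma card_dyadicTrunc_le {P : ℝ} (hP : 0 < P) (l : Fin (K + 1)) (c : DyadicCode N K P) :
    (Finset.univ.filter fun j => dyadicTrunc l c.1 j ≠ none).card
      ≤ ⌊2 / ((1 / 2 : ℝ) ^ (l : ℕ)) ^ P⌋₊ := by
  have hδ : 0 < ((1 / 2 : ℝ) ^ (l : ℕ)) ^ P := by positivity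
  rw [Nat.le_floor_iff (by positivity), le_div_iff₀ hδ]
  refine le_trans ?_ c.2
  rw [← nsmul_eq_mul]
  refine (Finset.card_nsmul_le_sum _ (fun j => |dyadicVal (c.1 j)| ^ P) _ fun j hj => ?_).trans
    (Finset.sum_le_univ_sum_of_nonneg fun j => by positivity)
  have h : (c.1 j).1 ≤ l := by
    by_contra h
    simp [dyadicTrunc, h] at hj
  rw [abs_dyadicVal]
  exact Real.rpow_le_rpow (by positivity)
    (pow_le_pow_of_le_one (by norm_num) (by norm_num) h) hP.le

lemma integral_ciSup_dyadicProcess_le [DecidableEq N] [Nonempty N] {P D Λ : ℝ} (hP : 0 < P)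
    (hD : 0 ≤ D) [Nonempty (DyadicCode N K P)] (hΛ : 0 < Λ)
    (hlog : Real.log (Fintype.card N * (2 * (K + 1) + 1)) ≤ Λ) :
    ∫ g, ⨆ c : DyadicCode N K P, linImage (dyadicProcess P D) g c
        ∂(_root_.stdGaussian (Fin (K + 1) × (N → Option (Fin (K + 1) × Bool))))
      ≤ (K + 1) * (D * (2 * Real.sqrt (12 * Λ))) := by
  set δ : Fin (K + 1) → ℝ := fun l => ((1 / 2 : ℝ) ^ (l : ℕ)) ^ P with hδ
  have hδ0 : ∀ l, 0 < δ l := fun l => by simp only [hδ]; positivity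
  set J : Fin (K + 1) → Finset (N → Option (Fin (K + 1) × Bool)) := fun l =>
    Finset.univ.filter fun c => (Finset.univ.filter fun j => c j ≠ none).card ≤ ⌊2 / δ l⌋₊ with hJ
  have hJn : ∀ l, Nonempty (J l) := fun l => ⟨⟨fun _ => none, by simp [hJ]⟩⟩
  set V : (l : Fin (K + 1)) → J l → Unit → Fin (K + 1) × (N → Option (Fin (K + 1) × Bool)) → ℝ :=
    fun l w _ => Pi.single (l, w.1) 1 with hV
  have hVl : ∀ l w k g, linImage (V l w) g k = g (l, w.1) := fun l w k g => by
    simp [linImage, hV, Pi.single_apply]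
  have hmax : ∀ l, ∫ g, ⨆ x : J l × Unit, linImage (fun x : J l × Unit => V l x.1 x.2) g x
      ∂(_root_.stdGaussian (Fin (K + 1) × (N → Option (Fin (K + 1) × Bool))))
      ≤ 0 + 2 * 1 * Real.sqrt (2 / δ l * Λ) := fun l => by
    have hL : 0 < 2 / δ l * Λ := mul_pos (div_pos two_pos (hδ0 l)) hΛ
    refine integral_ciSup_prod_le zero_le_one hL ?_ (fun w k => ?_) fun w => ?_
    · have hc : Fintype.card (J l) ≤ (Fintype.card N * (2 * (K + 1) + 1)) ^ ⌊2 / δ l⌋₊ := by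
        have := card_filter_ne_none_le (N := N) (V := Fin (K + 1) × Bool) ⌊2 / δ l⌋₊
        rw [Fintype.card_coe]
        simpa [hJ, mul_comm] using this
      have hpos : (0 : ℝ) < Fintype.card (J l) := by exact_mod_cast Fintype.card_pos
      have hc' : (Fintype.card (J l) : ℝ)
          ≤ ((Fintype.card N : ℝ) * (2 * (K + 1) + 1)) ^ ⌊2 / δ l⌋₊ := by exact_mod_cast hc
      refine (Real.log_le_log hpos hc').trans ?_
      rw [Real.log_pow]
      have := Nat.floor_le (div_pos two_pos (hδ0 l)).le
      exact (mul_le_mul_of_nonneg_left hlog (Nat.cast_nonneg _)).trans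
        (mul_le_mul_of_nonneg_right this hΛ.le)
    · simp [hV, Pi.single_apply]
    · simp_rw [hVl, ciSup_const]
      exact (integral_eval_stdGaussian _).le
  have hint := fun l => integrable_ciSup_linImage (fun x : J l × Unit => V l x.1 x.2)
  set σ : Fin (K + 1) → ℝ := fun l => Real.sqrt (6 * D ^ 2 * δ l) with hσ
  have hpt : ∀ g, ⨆ c : DyadicCode N K P, linImage (dyadicProcess P D) g c
      ≤ ∑ l, σ l * ⨆ x : J l × Unit, linImage (fun x : J l × Unit => V l x.1 x.2) g x := by
    intro g
    refine ciSup_le fun c => ?_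
    have e : linImage (dyadicProcess P D) g c = ∑ l, σ l * g (l, dyadicTrunc l c.1) := by
      rw [linImage, Fintype.sum_prod_type]
      simp [dyadicProcess, hσ, hδ]
    rw [e]
    refine Finset.sum_le_sum fun l _ => mul_le_mul_of_nonneg_left ?_ (Real.sqrt_nonneg _)
    have hmem : dyadicTrunc l c.1 ∈ J l := by
      simpa [hJ, hδ] using card_dyadicTrunc_le hP l c
    have := le_ciSup_finite (fun x : J l × Unit => linImage (fun x : J l × Unit => V l x.1 x.2) g x)
      (⟨_, hmem⟩, ())
    refine le_trans (le_of_eq ?_) this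
    exact (hVl l ⟨_, hmem⟩ () g).symm
  refine (integral_mono (integrable_ciSup_linImage _)
    (integrable_finsetSum _ fun l _ => (hint l).const_mul (σ l)) hpt).trans ?_
  rw [integral_finsetSum _ fun l _ => (hint l).const_mul (σ l)]
  simp_rw [integral_const_mul]
  calc _ ≤ ∑ l, σ l * (0 + 2 * 1 * Real.sqrt (2 / δ l * Λ)) :=
        Finset.sum_le_sum fun l _ => mul_le_mul_of_nonneg_left (hmax l) (Real.sqrt_nonneg _)
    _ = ∑ _l : Fin (K + 1), D * (2 * Real.sqrt (12 * Λ)) := by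
        refine Finset.sum_congr rfl fun l _ => ?_
        have h := (hδ0 l).ne'
        have h1 : 6 * D ^ 2 * δ l * (2 / δ l * Λ) = D ^ 2 * (12 * Λ) := by field_simp; ring
        rw [zero_add, mul_one, mul_left_comm, hσ, ← Real.sqrt_mul (by
          have := (hδ0 l).le; positivity), h1, Real.sqrt_mul (sq_nonneg D), Real.sqrt_sq hD]
        ring
    _ = _ := by simp

end Dyadic

section

variable {I : Type*} [Fintype I]

lemma continuous_sum_abs_rpow {q : ℝ} (hq : 0 < q) (c : I → ℝ) :
    Continuous fun g : I → ℝ => (∑ i, |c i * g i| ^ q) ^ (1 / q) := by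
  refine Continuous.rpow_const ?_ fun _ => Or.inr (by positivity)
  exact continuous_finsetSum _ fun i _ =>
    Continuous.rpow_const (by fun_prop) fun _ => Or.inr hq.le

/-- First moment of the `ℓ_q` norm of a Gaussian vector with independent coordinates. -/
lemma integral_sum_abs_rpow_le {q : ℝ} (hq : 1 ≤ q) (c : I → ℝ) :
    Integrable (fun g : I → ℝ => (∑ i, |c i * g i| ^ q) ^ (1 / q)) (_root_.stdGaussian I) ∧
    ∫ g, (∑ i, |c i * g i| ^ q) ^ (1 / q) ∂(_root_.stdGaussian I)
      ≤ Real.exp 2 * Real.sqrt q * (∑ i, |c i| ^ q) ^ (1 / q) := by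
  have hq0 : 0 < q := by linarith
  obtain ⟨hint, hle⟩ := integral_abs_rpow_gaussianReal_le hq
  have hcont : Continuous fun x : ℝ => |x| ^ q :=
    continuous_abs.rpow_const fun _ => Or.inr hq0.le
  have hi : ∀ i, Integrable (fun g : I → ℝ => |c i * g i| ^ q) (_root_.stdGaussian I) := fun i => by
    have mp : MeasurePreserving (Function.eval i) (_root_.stdGaussian I) (gaussianReal 0 1) :=
      measurePreserving_eval (fun _ : I => gaussianReal 0 1) i
    have := (mp.integrable_comp_of_integrable hint).const_mul (|c i| ^ q)
    refine this.congr (Filter.Eventually.of_forall fun g => ?_)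
    simp [abs_mul, Real.mul_rpow]
  have hsum := integrable_finsetSum Finset.univ fun i _ => hi i
  have h0 : ∀ g : I → ℝ, 0 ≤ ∑ i, |c i * g i| ^ q := fun g => by positivity
  have hroot : Integrable (fun g : I → ℝ => (∑ i, |c i * g i| ^ q) ^ (1 / q))
      (_root_.stdGaussian I) := by
    refine (hsum.add (integrable_const 1)).mono'
      (continuous_sum_abs_rpow hq0 c).aestronglyMeasurable (Filter.Eventually.of_forall fun g => ?_)
    rw [Real.norm_of_nonneg (Real.rpow_nonneg (h0 g) _)]
    have h1 : (1 : ℝ) ≤ (∑ i, |c i * g i| ^ q) + 1 := by linarith [h0 g]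
    calc (∑ i, |c i * g i| ^ q) ^ (1 / q) ≤ ((∑ i, |c i * g i| ^ q) + 1) ^ (1 / q) :=
          Real.rpow_le_rpow (h0 g) (by linarith) (by positivity)
      _ ≤ ((∑ i, |c i * g i| ^ q) + 1) ^ (1 : ℝ) :=
          Real.rpow_le_rpow_of_exponent_le h1 (by rw [div_le_one hq0]; exact hq)
      _ = _ := Real.rpow_one _
  refine ⟨hroot, ?_⟩
  have hjensen := (Real.concaveOn_rpow (p := 1 / q) (by positivity)
    (by rw [div_le_one hq0]; exact hq)).le_map_integral
    (Real.continuous_rpow_const (by positivity)).continuousOn isClosed_Ici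
    (Filter.Eventually.of_forall h0) hsum hroot
  refine hjensen.trans ?_
  rw [integral_finsetSum _ fun i _ => hi i]
  have hterm : ∀ i, ∫ g : I → ℝ, |c i * g i| ^ q ∂(_root_.stdGaussian I)
      ≤ |c i| ^ q * (Real.exp 2 * Real.sqrt q) ^ q := fun i => by
    simp_rw [abs_mul, Real.mul_rpow (abs_nonneg _) (abs_nonneg _)]
    rw [integral_const_mul, integral_comp_eval_stdGaussian i hcont]
    exact mul_le_mul_of_nonneg_left hle (by positivity)
  calc (∑ i, ∫ g : I → ℝ, |c i * g i| ^ q ∂(_root_.stdGaussian I)) ^ (1 / q)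
      ≤ ((∑ i, |c i| ^ q) * (Real.exp 2 * Real.sqrt q) ^ q) ^ (1 / q) := by
        rw [Finset.sum_mul]
        exact Real.rpow_le_rpow (Finset.sum_nonneg fun i _ => integral_nonneg fun g => by positivity)
          (Finset.sum_le_sum fun i _ => hterm i) (by positivity)
    _ = _ := by
        rw [Real.mul_rpow (by positivity) (by positivity), ← Real.rpow_mul (by positivity),
          mul_one_div_cancel hq0.ne', Real.rpow_one, mul_comm]

/-- Interpolation of Hölder's inequality between `ℓ_2` and `ℓ_r` weights. -/
lemma sum_mul_rpow_mul_le {r q : ℝ} (hrq : r.HolderConjugate q) (hr2 : r ≤ 2) {w s : I → ℝ}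
    (hw : ∑ i, w i ^ 2 ≤ 1) (hs : ∑ i, |s i| ^ r ≤ 1) (y : I → ℝ) :
    ∑ i, w i * |s i| ^ ((2 - r) / 2) * y i ≤ (∑ i, |y i| ^ q) ^ (1 / q) := by
  have hr0 := hrq.pos
  have hz : ∑ i, |w i * |s i| ^ ((2 - r) / 2)| ^ r ≤ 1 := by
    calc ∑ i, |w i * |s i| ^ ((2 - r) / 2)| ^ r
        ≤ ∑ i, (r / 2 * w i ^ 2 + (1 - r / 2) * |s i| ^ r) := by
          refine Finset.sum_le_sum fun i _ => ?_
          have h := Real.geom_mean_le_arith_mean2_weighted (w₁ := r / 2) (w₂ := 1 - r / 2)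
            (p₁ := |w i| ^ (2 : ℝ)) (p₂ := |s i| ^ r) (by positivity) (by linarith)
            (by positivity) (by positivity) (by ring)
          rw [← Real.rpow_mul (abs_nonneg _), ← Real.rpow_mul (abs_nonneg _)] at h
          rw [abs_mul, Real.mul_rpow (abs_nonneg _) (abs_nonneg _),
            abs_of_nonneg (Real.rpow_nonneg (abs_nonneg (s i)) _), ← Real.rpow_mul (abs_nonneg _)]
          rw [Real.rpow_two, sq_abs] at h
          convert! h using 3 <;> ring
      _ = r / 2 * ∑ i, w i ^ 2 + (1 - r / 2) * ∑ i, |s i| ^ r := by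
          rw [Finset.sum_add_distrib, Finset.mul_sum, Finset.mul_sum]
      _ ≤ r / 2 * 1 + (1 - r / 2) * 1 := by
          have : 0 ≤ 1 - r / 2 := by linarith
          gcongr
      _ = 1 := by ring
  refine (Real.inner_le_Lp_mul_Lq Finset.univ _ y hrq).trans ?_
  refine mul_le_of_le_one_left (by positivity) ?_
  exact Real.rpow_le_one (by positivity) hz (by have := hr0; positivity)

lemma sum_mul_le_of_sum_rpow_le {r : ℝ} (hr0 : 0 ≤ r) (hr2 : r ≤ 2) {s : I → ℝ}
    (hs : ∑ i, |s i| ^ r ≤ 1) (y : I → ℝ) :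
    ∑ i, s i * y i ≤ Real.sqrt (∑ i, (|s i| ^ ((2 - r) / 2) * y i) ^ 2) := by
  have h := Real.sum_mul_le_sqrt_mul_sqrt Finset.univ (fun i => |s i| ^ (r / 2))
    (fun i => |s i| ^ ((2 - r) / 2) * |y i|)
  have e1 : ∀ i, (|s i| ^ (r / 2)) ^ 2 = |s i| ^ r := fun i => by
    rw [← Real.rpow_mul_natCast (abs_nonneg _)]; congr 1; push_cast; ring
  have e2 : ∀ i, |s i| ^ (r / 2) * (|s i| ^ ((2 - r) / 2) * |y i|) = |s i| * |y i| := fun i => by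
    rw [← mul_assoc, ← Real.rpow_add_of_nonneg (abs_nonneg _) (by linarith) (by linarith),
      ← add_div, add_sub_cancel, div_self two_ne_zero, Real.rpow_one]
  simp only [e1, e2, mul_pow, sq_abs] at h
  calc ∑ i, s i * y i ≤ ∑ i, |s i| * |y i| :=
        Finset.sum_le_sum fun i _ => (le_abs_self _).trans (abs_mul _ _).le
    _ ≤ _ := h
    _ ≤ _ := by
        simp only [mul_pow]
        exact mul_le_of_le_one_left (Real.sqrt_nonneg _) (Real.sqrt_le_one.2 hs)

end

section

variable {I N S T : Type*} [Fintype I] [Fintype N] [Nonempty N] [Fintype S] [Nonempty S]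
  [Fintype T] [Nonempty T]

/-- The part of the comparison process which depends on `t` through row norms only. -/
lemma integral_ciSup_rowNorm_le (A : I → N → ℝ) (s : S → I → ℝ) (t : T → N → ℝ)
    {r q b D V L : ℝ} (hrq : r.HolderConjugate q) (hr2 : r ≤ 2) (hs : ∀ x, ∑ i, |s x i| ^ r ≤ 1)
    (hb0 : 0 ≤ b) (hb : ∀ x i, |s x i| ^ ((2 - r) / 2) ≤ b) (ht : ∀ y, ∑ j, t y j ^ 2 ≤ 2)
    (hD0 : 0 ≤ D) (hD : ∀ i j, |A i j| ≤ D) (hV : ∀ j, (∑ i, |A i j| ^ q) ^ (1 / q) ≤ V)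
    (hL : 0 < L) (hN : Real.log (Fintype.card N) ≤ L) :
    ∫ g, ⨆ x : S × T, linImage (fun (x : S × T) (i : I) =>
        s x.1 i * Real.sqrt (∑ j, A i j ^ 2 * t x.2 j ^ 2)) g x ∂(_root_.stdGaussian I)
      ≤ 3 * (Real.exp 2 * Real.sqrt q * V + 2 * (b * D) * Real.sqrt L) := by
  obtain ⟨W, hWn, hW1, hW2⟩ := exists_finset_sqrt_sum_sq_le I
  have : Nonempty W := hWn.to_subtype
  set u : N → S × W → I → ℝ := fun j k i => k.2.1 i * |s k.1 i| ^ ((2 - r) / 2) * A i j with hu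
  have h1 : ∫ g, ⨆ x : N × (S × W), linImage (fun x : N × (S × W) => u x.1 x.2) g x
      ∂(_root_.stdGaussian I)
      ≤ Real.exp 2 * Real.sqrt q * V + 2 * (b * D) * Real.sqrt L := by
    refine integral_ciSup_prod_le (by positivity) hL hN (fun j k => ?_) fun j => ?_
    · calc ∑ i, u j k i ^ 2 ≤ ∑ i, k.2.1 i ^ 2 * (b * D) ^ 2 := by
            refine Finset.sum_le_sum fun i _ => ?_
            have h2 := hb k.1 i
            have h3 := hD i j
            have h4 : 0 ≤ |s k.1 i| ^ ((2 - r) / 2) := by positivity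
            simp only [hu]
            rw [mul_assoc, mul_pow, mul_pow (|s k.1 i| ^ ((2 - r) / 2)), mul_pow b,
              ← sq_abs (A i j)]
            gcongr
        _ ≤ 1 * (b * D) ^ 2 := by
            rw [← Finset.sum_mul]
            exact mul_le_mul_of_nonneg_right (hW1 _ k.2.2) (sq_nonneg _)
        _ = _ := one_mul _
    · obtain ⟨hi, hle⟩ := integral_sum_abs_rpow_le hrq.symm.lt.le fun i => A i j
      refine (integral_mono (integrable_ciSup_linImage _) hi fun g => ciSup_le fun k => ?_).trans
        (hle.trans ?_)
      · have := sum_mul_rpow_mul_le hrq hr2 (hW1 _ k.2.2) (hs k.1) fun i => A i j * g i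
        simpa only [linImage, hu, mul_assoc] using this
      · exact mul_le_mul_of_nonneg_left (hV j) (by positivity)
  have hpt : ∀ g : I → ℝ, ⨆ x : S × T, linImage (fun (x : S × T) (i : I) =>
        s x.1 i * Real.sqrt (∑ j, A i j ^ 2 * t x.2 j ^ 2)) g x
      ≤ 3 * ⨆ x : N × (S × W), linImage (fun x : N × (S × W) => u x.1 x.2) g x := fun g => by
    refine ciSup_le fun x => ?_
    set Y := ⨆ x : N × (S × W), linImage (fun x : N × (S × W) => u x.1 x.2) g x with hY
    have hnet : ∀ j, Real.sqrt (∑ i, (|s x.1 i| ^ ((2 - r) / 2) * (A i j * g i)) ^ 2)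
        ≤ 2 * Y := fun j => by
      obtain ⟨w, hw, h⟩ := hW2 fun i => |s x.1 i| ^ ((2 - r) / 2) * (A i j * g i)
      refine h.trans (mul_le_mul_of_nonneg_left ?_ zero_le_two)
      refine le_trans (le_of_eq ?_) (le_ciSup_finite _ (j, (x.1, ⟨w, hw⟩)))
      simp only [linImage, hu, mul_assoc]
    obtain ⟨j₀⟩ := ‹Nonempty N›
    have hY0 : 0 ≤ Y := by linarith [(Real.sqrt_nonneg _).trans (hnet j₀)]
    calc linImage (fun (x : S × T) (i : I) =>
          s x.1 i * Real.sqrt (∑ j, A i j ^ 2 * t x.2 j ^ 2)) g x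
        = ∑ i, s x.1 i * (Real.sqrt (∑ j, A i j ^ 2 * t x.2 j ^ 2) * g i) := by
          simp only [linImage, mul_assoc]
      _ ≤ Real.sqrt (∑ i, (|s x.1 i| ^ ((2 - r) / 2) *
            (Real.sqrt (∑ j, A i j ^ 2 * t x.2 j ^ 2) * g i)) ^ 2) :=
          sum_mul_le_of_sum_rpow_le hrq.pos.le hr2 (hs x.1) _
      _ = Real.sqrt (∑ j, t x.2 j ^ 2 *
            ∑ i, (|s x.1 i| ^ ((2 - r) / 2) * (A i j * g i)) ^ 2) := by
          congr 1
          simp_rw [mul_pow, Finset.mul_sum]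
          rw [Finset.sum_comm]
          refine Finset.sum_congr rfl fun i _ => ?_
          rw [Real.sq_sqrt (by positivity), Finset.sum_mul, Finset.mul_sum]
          exact Finset.sum_congr rfl fun j _ => by ring
      _ ≤ Real.sqrt (∑ j, t x.2 j ^ 2 * (2 * Y) ^ 2) := by
          refine Real.sqrt_le_sqrt (Finset.sum_le_sum fun j _ =>
            mul_le_mul_of_nonneg_left ?_ (sq_nonneg _))
          exact (Real.sqrt_le_left (by positivity)).1 (hnet j)
      _ ≤ Real.sqrt ((3 * Y) ^ 2) := by
          refine Real.sqrt_le_sqrt ?_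
          rw [← Finset.sum_mul]
          nlinarith [ht x.2, sq_nonneg Y, mul_le_mul_of_nonneg_right (ht x.2) (sq_nonneg (2 * Y))]
      _ = 3 * Y := Real.sqrt_sq (by positivity)
  refine (integral_mono (integrable_ciSup_linImage _)
    ((integrable_ciSup_linImage _).const_mul 3) hpt).trans ?_
  rw [integral_const_mul]
  exact mul_le_mul_of_nonneg_left h1 (by norm_num)

end

section Exponents

lemma holderConjugate_toReal {q r : ℝ≥0∞} (h : 1 / q + 1 / r = 1) (hq : 2 < q) (hq' : q ≠ ⊤) :
    r ≠ ⊤ ∧ r.toReal.HolderConjugate q.toReal ∧ r.toReal ≤ 2 := by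
  have hq0 : q ≠ 0 := (zero_le_two.trans_lt hq).ne'
  have hr0 : r ≠ 0 := by rintro rfl; simp at h
  have hr : r ≠ ⊤ := by
    rintro rfl
    simp only [one_div, ENNReal.inv_top, add_zero, ENNReal.inv_eq_one] at h
    rw [h] at hq; norm_num at hq
  have hq2 : 2 < q.toReal := by
    simpa using (ENNReal.toReal_lt_toReal (by simp) hq').2 hq
  have hr1 : 0 < r.toReal := ENNReal.toReal_pos hr0 hr
  have h1 := congrArg ENNReal.toReal h
  rw [ENNReal.toReal_add (by simp [hq0]) (by simp [hr0])] at h1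
  simp only [one_div, ENNReal.toReal_inv, ENNReal.toReal_one] at h1
  have hqi : q.toReal⁻¹ < 2⁻¹ := inv_strictAnti₀ two_pos hq2
  have hqi0 : 0 < q.toReal⁻¹ := by positivity
  refine ⟨hr, (Real.holderConjugate_iff).2 ⟨?_, by linarith⟩, ?_⟩
  · exact (inv_lt_one₀ hr1).1 (by linarith)
  · exact (inv_le_inv₀ two_pos hr1).1 (by linarith)

lemma toReal_mem_Icc_of_two_le {p r : ℝ≥0∞} (h : 1 / p + 1 / r = 1) (hr : 2 ≤ r) :
    p ≠ ⊤ ∧ 1 ≤ p.toReal ∧ p.toReal ≤ 2 := by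
  have hr0 : r ≠ 0 := (two_pos.trans_le hr).ne'
  have hp0 : p ≠ 0 := by rintro rfl; simp at h
  have hp : p ≠ ⊤ := by
    rintro rfl
    simp only [one_div, ENNReal.inv_top, zero_add, ENNReal.inv_eq_one] at h
    rw [h] at hr; norm_num at hr
  have hp1 : 0 < p.toReal := ENNReal.toReal_pos hp0 hp
  have h1 := congrArg ENNReal.toReal h
  rw [ENNReal.toReal_add (by simp [hp0]) (by simp [hr0])] at h1
  simp only [one_div, ENNReal.toReal_inv, ENNReal.toReal_one] at h1
  have h2 : r.toReal⁻¹ ≤ 2⁻¹ := by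
    have := ENNReal.toReal_mono (by simp) (ENNReal.inv_le_inv.2 hr)
    simpa using this
  have h3 : 0 ≤ r.toReal⁻¹ := by positivity
  exact ⟨hp, (inv_le_one₀ hp1).1 (by linarith), (inv_le_inv₀ two_pos hp1).1 (by linarith)⟩

end Exponents

section Log

lemma one_le_Log (x : ℝ) : 1 ≤ Log x := le_max_left _ _

lemma log_two_add_one_le (n : ℕ) : ((Nat.log 2 n + 1 : ℕ) : ℝ) + 1 ≤ 4 * Log n := by
  have h1 := one_le_Log n
  have h2 : (Nat.log 2 n : ℝ) * Real.log 2 ≤ Log n := by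
    rcases Nat.eq_zero_or_pos n with rfl | hn
    · simpa using zero_le_one.trans h1
    · refine le_trans ?_ (le_max_right _ _)
      rw [← Real.log_pow]
      exact Real.log_le_log (by positivity) (by exact_mod_cast Nat.pow_log_le_self 2 hn.ne')
  have h3 := Real.log_two_gt_d9
  have h4 : (0 : ℝ) ≤ Nat.log 2 n := Nat.cast_nonneg _
  push_cast
  nlinarith

lemma log_mul_le {n : ℕ} (hn : 0 < n) :
    Real.log (n * (2 * (((Nat.log 2 n + 1 : ℕ) : ℝ) + 1) + 1)) ≤ 4 * Log n := by
  have h1 := one_le_Log n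
  have hn' : (0 : ℝ) < n := by exact_mod_cast hn
  have h2 := log_two_add_one_le n
  have h3 : 2 * (((Nat.log 2 n + 1 : ℕ) : ℝ) + 1) + 1 ≤ 9 * Log n := by linarith
  rw [Real.log_mul hn'.ne' (by positivity)]
  have h4 : Real.log (2 * (((Nat.log 2 n + 1 : ℕ) : ℝ) + 1) + 1) ≤ Real.log (9 * Log n) :=
    Real.log_le_log (by positivity) h3
  rw [Real.log_mul (by norm_num) (by linarith)] at h4
  have h5 : Real.log 9 ≤ 3 := by
    rw [Real.log_le_iff_le_exp (by norm_num)]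
    have h6 : (2.7 : ℝ) ≤ Real.exp 1 := by linarith [Real.exp_one_gt_d9]
    calc (9 : ℝ) ≤ 2.7 ^ 3 := by norm_num
      _ ≤ Real.exp 1 ^ 3 := by gcongr
      _ = Real.exp 3 := by rw [← Real.exp_nat_mul]; norm_num
  have h6 := Real.log_le_sub_one_of_pos (show 0 < Log n by linarith)
  have h7 : Real.log n ≤ Log n := le_max_right _ _
  linarith

end Log

section Dyadic

variable {N : Type*} [Fintype N] {K : ℕ}

lemma exists_dyadicCode_sum_le {P : ℝ} (hP : 1 ≤ P) (hK : Fintype.card N ≤ 2 ^ K) (t : N → ℝ)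
    (ht : ∑ j, |t j| ^ P ≤ 1) (c : N → ℝ) :
    ∃ d : DyadicCode N K P, ∑ j, c j * t j ≤ 2 * ∑ j, c j * dyadicVal (d.1 j) := by
  have hP0 : 0 < P := by linarith
  have ht1 : ∀ j, |t j| ≤ 1 := fun j => by
    have := (Finset.single_le_sum (f := fun j => |t j| ^ P) (fun _ _ => by positivity)
      (Finset.mem_univ j)).trans ht
    by_contra hlt
    exact absurd this (not_le.2 (Real.one_lt_rpow (not_le.1 hlt) hP0))
  choose k hk h1 h2 using fun j => exists_dyadic_approx K (ht1 j)
  have hd : ∀ j b, |dyadicVal ((⟨k j, Nat.lt_succ_of_le (hk j)⟩, b) : Fin (K + 1) × Bool)|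
      = (1 / 2) ^ k j := fun j b => abs_dyadicVal _
  refine ⟨⟨fun j => (⟨k j, Nat.lt_succ_of_le (hk j)⟩, decide (0 ≤ c j)), ?_⟩, ?_⟩
  · simp only [hd]
    have hK1 : ((1 / 2 : ℝ) ^ K) ^ P ≤ (1 / 2) ^ K := by
      have h3 : (1 / 2 : ℝ) ^ K ≤ 1 := pow_le_one₀ (by norm_num) (by norm_num)
      exact Real.rpow_le_self_of_le_one (by positivity) h3 hP
    have hterm : ∀ j, ((1 / 2 : ℝ) ^ k j) ^ P ≤ |t j| ^ P + (1 / 2) ^ K := fun j => by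
      rcases h2 j with h | h
      · have := Real.rpow_le_rpow (by positivity) h hP0.le
        have h3 : (0 : ℝ) ≤ (1 / 2) ^ K := by positivity
        linarith
      · rw [h]
        have : 0 ≤ |t j| ^ P := by positivity
        linarith
    have hcard : (Fintype.card N : ℝ) * (1 / 2) ^ K ≤ 1 := by
      rw [one_div, inv_pow, ← div_eq_mul_inv, div_le_one (by positivity)]
      exact_mod_cast hK
    calc ∑ j, ((1 / 2 : ℝ) ^ k j) ^ P ≤ ∑ j, (|t j| ^ P + (1 / 2) ^ K) :=
          Finset.sum_le_sum fun j _ => hterm j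
      _ = ∑ j, |t j| ^ P + Fintype.card N * (1 / 2) ^ K := by
          rw [Finset.sum_add_distrib]; simp
      _ ≤ 2 := by linarith
  · rw [Finset.mul_sum]
    refine Finset.sum_le_sum fun j _ => ?_
    have h3 : c j * dyadicVal ((⟨k j, Nat.lt_succ_of_le (hk j)⟩, decide (0 ≤ c j)) :
        Fin (K + 1) × Bool) = |c j| * (1 / 2) ^ k j := by
      rw [dyadicVal]
      by_cases h : 0 ≤ c j
      · simp [h, abs_of_nonneg h]
      · simp [h, abs_of_neg (not_le.1 h)]
    rw [h3]
    calc c j * t j ≤ |c j| * |t j| := (le_abs_self _).trans (abs_mul _ _).le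
      _ ≤ |c j| * (2 * (1 / 2) ^ k j) := mul_le_mul_of_nonneg_left (h1 j) (abs_nonneg _)
      _ = _ := by ring

variable {I S : Type*} [Fintype I] [Fintype S] [Nonempty S]

lemma integral_ciSup_dyadicCode_le [DecidableEq N] [Nonempty N] (A : I → N → ℝ) (s : S → I → ℝ)
    {P r q b D V L Λ : ℝ} [Nonempty (DyadicCode N K P)] (hP0 : 0 < P) (hP2 : P ≤ 2)
    (hrq : r.HolderConjugate q) (hr2 : r ≤ 2) (hs : ∀ x, ∑ i, |s x i| ^ r ≤ 1)
    (hb0 : 0 ≤ b) (hb : ∀ x i, |s x i| ^ ((2 - r) / 2) ≤ b)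
    (hD0 : 0 ≤ D) (hD : ∀ i j, |A i j| ≤ D)
    (hA : ∀ i (δ : ℝ) (τ : N → ℝ), 0 ≤ δ → (∀ j, |τ j| ≤ δ) → ∑ j, |τ j| ^ P ≤ 2 →
      ∑ j, A i j ^ 2 * τ j ^ 2 ≤ 3 * D ^ 2 * δ ^ P)
    (hV : ∀ j, (∑ i, |A i j| ^ q) ^ (1 / q) ≤ V)
    (hL : 0 < L) (hN : Real.log (Fintype.card N) ≤ L) (hΛ : 0 < Λ)
    (hlog : Real.log (Fintype.card N * (2 * (K + 1) + 1)) ≤ Λ) :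
    ∫ g, ⨆ x : S × DyadicCode N K P, linImage (fun (x : S × DyadicCode N K P) (e : I × N) =>
        A e.1 e.2 * s x.1 e.1 * dyadicVal (x.2.1 e.2)) g x ∂(_root_.stdGaussian (I × N))
      ≤ 3 * (Real.exp 2 * Real.sqrt q * V + 2 * (b * D) * Real.sqrt L)
        + b * ((K + 1) * (D * (2 * Real.sqrt (12 * Λ)))) := by
  refine (integral_ciSup_bilinear_le A s (fun (c : DyadicCode N K P) j => dyadicVal (c.1 j))
    (dyadicProcess P D) hb0 (fun x => ?_) fun c c' i =>
      sum_sq_sub_le_dyadicProcess hP0 (hA i) c c').trans (add_le_add ?_ ?_)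
  · calc ∑ i, s x i ^ 2 ≤ ∑ i, b ^ 2 * |s x i| ^ r := by
          refine Finset.sum_le_sum fun i _ => ?_
          have h1 : s x i ^ 2 = (|s x i| ^ ((2 - r) / 2)) ^ 2 * |s x i| ^ r := by
            rw [← Real.rpow_mul_natCast (abs_nonneg _),
              ← Real.rpow_add_of_nonneg (abs_nonneg _) (by push_cast; linarith) hrq.pos.le]
            push_cast
            rw [div_mul_cancel₀ _ two_ne_zero, sub_add_cancel, Real.rpow_two, sq_abs]
          rw [h1]
          exact mul_le_mul_of_nonneg_right (pow_le_pow_left₀ (by positivity) (hb x i) 2)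
            (by positivity)
      _ ≤ b ^ 2 * 1 := by
          rw [← Finset.mul_sum]
          exact mul_le_mul_of_nonneg_left (hs x) (sq_nonneg _)
      _ = b ^ 2 := mul_one _
  · refine integral_ciSup_rowNorm_le A s (fun (c : DyadicCode N K P) j => dyadicVal (c.1 j))
      hrq hr2 hs hb0 hb (fun c => ?_) hD0 hD hV hL hN
    refine (Finset.sum_le_sum fun j _ => ?_).trans c.2
    have h1 : |dyadicVal (c.1 j)| ≤ 1 := by
      rw [abs_dyadicVal]; exact pow_le_one₀ (by norm_num) (by norm_num)
    have h0 : 0 < |dyadicVal (c.1 j)| := by rw [abs_dyadicVal]; positivity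
    rw [← sq_abs, ← Real.rpow_two]
    exact Real.rpow_le_rpow_of_exponent_ge h0 h1 hP2
  · exact mul_le_mul_of_nonneg_left (integral_ciSup_dyadicProcess_le hP0 hD0 hΛ hlog) hb0

end Dyadic

section

variable {I N Θ : Type*} [Fintype I] [Fintype N] [Fintype Θ] [Nonempty Θ]

/-- Reduction of the supremum of a Gaussian bilinear form to finite families. -/
lemma integral_sSup_bilinear_le (A : I → N → ℝ) {U : Set (I → ℝ)} {V : Set (N → ℝ)} {a F : ℝ}
    (hU : ∀ s ∈ U, ∀ i, |s i| ≤ a) (hU0 : 0 ∈ U) (hV : ∀ t ∈ V, ∀ j, |t j| ≤ 1) (hV0 : 0 ∈ V)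
    (τ : Θ → N → ℝ)
    (hτ : ∀ t ∈ V, ∀ c : N → ℝ, ∃ d, ∑ j, c j * t j ≤ 2 * ∑ j, c j * τ d j)
    (hF : ∀ S : Finset (I → ℝ), S.Nonempty → (S : Set (I → ℝ)) ⊆ U →
      ∫ g, ⨆ x : S × Θ, linImage (fun (x : S × Θ) (e : I × N) =>
        A e.1 e.2 * x.1.1 e.1 * τ x.2 e.2) g x ∂(_root_.stdGaussian (I × N)) ≤ F) :
    ∫ g, sSup {x : ℝ | ∃ s t, s ∈ U ∧ t ∈ V ∧
        x = ∑ i, ∑ j, A i j * g (i, j) * s i * t j} ∂(_root_.stdGaussian (I × N)) ≤ 2 * F := by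
  set G : (I × N → ℝ) → ℝ := fun g => ∑ e, |A e.1 e.2| * |g e| with hG
  have hGi : Integrable G (_root_.stdGaussian (I × N)) := by
    refine integrable_finsetSum _ fun e _ => Integrable.const_mul ?_ _
    have mp : MeasurePreserving (Function.eval e) (_root_.stdGaussian (I × N))
      (gaussianReal 0 1) := measurePreserving_eval (fun _ : I × N => gaussianReal 0 1) e
    have h := (integral_abs_rpow_gaussianReal_le le_rfl).1
    simp only [Real.rpow_one] at h
    exact mp.integrable_comp_of_integrable h
  have hG0 : 0 ≤ ∫ g, G g ∂(_root_.stdGaussian (I × N)) :=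
    integral_nonneg fun g => Finset.sum_nonneg fun e _ => by positivity
  have hUtb : TotallyBounded U := by
    refine (isCompact_Icc (a := fun _ : I => -a) (b := fun _ => a)).totallyBounded.subset
      fun s hs => ?_
    exact ⟨fun i => (abs_le.1 (hU s hs i)).1, fun i => (abs_le.1 (hU s hs i)).2⟩
  refine le_of_forall_le_add_div hG0 fun β hβ => ?_
  obtain ⟨S, hSU, hSf, hcov⟩ := Metric.finite_approx_of_totallyBounded hUtb β⁻¹ (by positivity)
  have hnet : ∀ s ∈ U, ∃ s' ∈ S, ∀ i, |s i - s' i| ≤ β⁻¹ := fun s hs => by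
    have := hcov hs
    simp only [Set.mem_iUnion, Metric.mem_ball, exists_prop] at this
    obtain ⟨s', hs', h⟩ := this
    exact ⟨s', hs', fun i => (dist_le_pi_dist s s' i).trans h.le⟩
  obtain ⟨s₀, hs₀, -⟩ := hnet 0 hU0
  have hne : hSf.toFinset.Nonempty := ⟨s₀, hSf.mem_toFinset.2 hs₀⟩
  have : Nonempty hSf.toFinset := hne.to_subtype
  set Y : (I × N → ℝ) → ℝ := fun g => ⨆ x : hSf.toFinset × Θ,
    linImage (fun (x : hSf.toFinset × Θ) (e : I × N) =>
      A e.1 e.2 * x.1.1 e.1 * τ x.2 e.2) g x with hY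
  have hYi : Integrable Y (_root_.stdGaussian (I × N)) := integrable_ciSup_linImage _
  have hYF : ∫ g, Y g ∂(_root_.stdGaussian (I × N)) ≤ F :=
    hF hSf.toFinset hne (by simpa using hSU)
  have hmem : ∀ g : I × N → ℝ, ∀ x ∈ {x : ℝ | ∃ s t, s ∈ U ∧ t ∈ V ∧
      x = ∑ i, ∑ j, A i j * g (i, j) * s i * t j}, x ≤ β⁻¹ * G g + 2 * Y g := by
    rintro g x ⟨s, t, hs, ht, rfl⟩
    obtain ⟨s', hs', hss⟩ := hnet s hs
    obtain ⟨d, hd⟩ := hτ t ht fun j => ∑ i, A i j * g (i, j) * s' i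
    have h1 : ∑ i, ∑ j, A i j * g (i, j) * (s i - s' i) * t j ≤ β⁻¹ * G g := by
      rw [hG, Finset.mul_sum, Fintype.sum_prod_type]
      refine Finset.sum_le_sum fun i _ => Finset.sum_le_sum fun j _ => (le_abs_self _).trans ?_
      rw [abs_mul, abs_mul, abs_mul]
      calc |A i j| * |g (i, j)| * |s i - s' i| * |t j|
          ≤ |A i j| * |g (i, j)| * β⁻¹ * 1 := by
            have h2 := hss i
            have h3 := hV t ht j
            gcongr
        _ = _ := by ring
    have h2 : ∑ i, ∑ j, A i j * g (i, j) * s i * t j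
        = ∑ i, ∑ j, A i j * g (i, j) * (s i - s' i) * t j
          + ∑ j, (∑ i, A i j * g (i, j) * s' i) * t j := by
      simp_rw [Finset.sum_mul]
      rw [Finset.sum_comm (s := (Finset.univ : Finset N)), ← Finset.sum_add_distrib]
      refine Finset.sum_congr rfl fun i _ => ?_
      rw [← Finset.sum_add_distrib]
      exact Finset.sum_congr rfl fun j _ => by ring
    have h3 : ∑ j, (∑ i, A i j * g (i, j) * s' i) * τ d j ≤ Y g := by
      refine le_trans (le_of_eq ?_)
        (le_ciSup_finite _ ((⟨s', hSf.mem_toFinset.2 hs'⟩ : hSf.toFinset), d))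
      simp_rw [linImage, Finset.sum_mul, Fintype.sum_prod_type]
      rw [Finset.sum_comm]
      exact Finset.sum_congr rfl fun i _ => Finset.sum_congr rfl fun j _ => by ring
    rw [h2]
    linarith
  have h0 : ∀ g : I × N → ℝ, (0 : ℝ) ∈ {x : ℝ | ∃ s t, s ∈ U ∧ t ∈ V ∧
      x = ∑ i, ∑ j, A i j * g (i, j) * s i * t j} := fun g => ⟨0, 0, hU0, hV0, by simp⟩
  calc ∫ g, sSup {x : ℝ | ∃ s t, s ∈ U ∧ t ∈ V ∧
        x = ∑ i, ∑ j, A i j * g (i, j) * s i * t j} ∂(_root_.stdGaussian (I × N))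
      ≤ ∫ g, (β⁻¹ * G g + 2 * Y g) ∂(_root_.stdGaussian (I × N)) := by
        refine integral_mono_of_nonneg (Filter.Eventually.of_forall fun g => ?_)
          ((hGi.const_mul _).add (hYi.const_mul _)) (Filter.Eventually.of_forall fun g => ?_)
        · exact le_csSup ⟨_, hmem g⟩ (h0 g)
        · exact csSup_le ⟨0, h0 g⟩ (hmem g)
    _ = β⁻¹ * (∫ g, G g ∂(_root_.stdGaussian (I × N)))
          + 2 * ∫ g, Y g ∂(_root_.stdGaussian (I × N)) := by
        rw [integral_add (hGi.const_mul _) (hYi.const_mul _), integral_const_mul,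
          integral_const_mul]
    _ ≤ 2 * F + (∫ g, G g ∂(_root_.stdGaussian (I × N))) / β := by
        rw [div_eq_inv_mul]
        linarith

end

/-- Proposition: small coordinates of `s`: for `q > 2`, `p* ≥ 2`
and `a ∈ (0,1]`,
`E sup_{s ∈ B_{q*} ∩ a B_∞, t ∈ B_p} Σ a_{ij} g_{ij} s_i t_j
  ≤ C(√q D2 + a^{(2−q*)/2} D1 Log^{3/2} n)`. -/
theorem prop_bdd_coordinates_q :
    ∃ C : ℝ, 0 < C ∧
      ∀ p pstar q qstar : ℝ≥0∞,
        1 / p + 1 / pstar = 1 → 1 / q + 1 / qstar = 1 →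
        2 < q → q ≠ ⊤ → 2 ≤ pstar →
        ∀ a : ℝ, 0 < a → a ≤ 1 →
        ∀ (m n : ℕ), 0 < m → 0 < n → ∀ A : Fin m → Fin n → ℝ,
          (∫ g : Fin m × Fin n → ℝ,
              sSup { x : ℝ | ∃ s : Fin m → ℝ, ∃ t : Fin n → ℝ,
                lpNorm qstar s ≤ 1 ∧ (∀ i, |s i| ≤ a) ∧ lpNorm p t ≤ 1 ∧
                x = ∑ i, ∑ j, A i j * g (i, j) * s i * t j }
            ∂ stdGaussian (Fin m × Fin n)) ≤
            C * (Real.sqrt q.toReal * D2 q A +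
              a ^ ((2 - qstar.toReal) / 2) * D1 pstar A *
                Log (n : ℝ) ^ ((3 : ℝ) / 2)) := by
  refine ⟨6 * Real.exp 2 + 124, by positivity, ?_⟩
  intro p pstar q qstar hp hq hq2 hqt hps a ha0 ha1 m n hm hn A
  obtain ⟨hrt, hrq, hr2⟩ := holderConjugate_toReal hq hq2 hqt
  obtain ⟨hpt, hP1, hP2⟩ := toReal_mem_Icc_of_two_le hp hps
  have hr0 : qstar ≠ 0 := fun h => by simp [h] at hq
  have hp0 : p ≠ 0 := fun h => by simp [h] at hp
  have hps0 : pstar ≠ 0 := (two_pos.trans_le hps).ne'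
  have hP0 : 0 < p.toReal := by linarith
  have : Nonempty (Fin m) := ⟨⟨0, hm⟩⟩
  have : Nonempty (Fin n) := ⟨⟨0, hn⟩⟩
  have hD : ∀ i, _root_.lpNorm pstar (fun j => A i j) ≤ D1 pstar A := fun i =>
    le_ciSup_finite (fun i => _root_.lpNorm pstar (fun j => A i j)) i
  have hD0 : 0 ≤ D1 pstar A := Real.iSup_nonneg fun i => lpNorm_nonneg' _ _
  have hV : ∀ j, (∑ i, |A i j| ^ q.toReal) ^ (1 / q.toReal) ≤ D2 q A := fun j => by
    refine le_trans (le_of_eq ?_) (le_ciSup_finite (fun j => _root_.lpNorm q (fun i => A i j)) j)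
    simp [_root_.lpNorm, hqt]
  have hV0 : 0 ≤ D2 q A := Real.iSup_nonneg fun i => lpNorm_nonneg' _ _
  set K := Nat.log 2 n + 1
  set L := Log (n : ℝ)
  have hL1 : 1 ≤ L := one_le_Log _
  have hK : Fintype.card (Fin n) ≤ 2 ^ K := by
    rw [Fintype.card_fin]; exact (Nat.lt_pow_succ_log_self one_lt_two n).le
  have hb0 : 0 ≤ a ^ ((2 - qstar.toReal) / 2) := by positivity
  have hround : ∀ t : Fin n → ℝ, _root_.lpNorm p t ≤ 1 → ∀ c : Fin n → ℝ,
      ∃ d : DyadicCode (Fin n) K p.toReal,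
        ∑ j, c j * t j ≤ 2 * ∑ j, c j * dyadicVal (d.1 j) := fun t ht c =>
    exists_dyadicCode_sum_le hP1 hK t (by simpa using sum_rpow_le_of_lpNorm_le hpt hp0 ht) c
  have hzero : ∀ (r : ℝ≥0∞) (k : ℕ), r ≠ 0 → r ≠ ⊤ →
      _root_.lpNorm r (0 : Fin k → ℝ) ≤ 1 := fun r k h h' => by
    have h1 := ENNReal.toReal_pos h h'
    simp [_root_.lpNorm, h', Real.zero_rpow h1.ne', Real.zero_rpow (inv_pos.2 h1).ne']
  obtain ⟨d₀, -⟩ := hround 0 (hzero p n hp0 hpt) 0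
  have : Nonempty (DyadicCode (Fin n) K p.toReal) := ⟨d₀⟩
  have key := integral_sSup_bilinear_le A (a := a)
    (U := {s | _root_.lpNorm qstar s ≤ 1 ∧ ∀ i, |s i| ≤ a}) (V := {t | _root_.lpNorm p t ≤ 1})
    (fun s hs => hs.2) ⟨hzero qstar m hr0 hrt, fun i => by simpa using ha0.le⟩
    (fun t ht j => (abs_le_lpNorm hp0 t j).trans ht) (hzero p n hp0 hpt)
    (fun (d : DyadicCode (Fin n) K p.toReal) j => dyadicVal (d.1 j)) hround
    (fun S hSn hSU => by
      have : Nonempty S := hSn.to_subtype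
      exact integral_ciSup_dyadicCode_le A (fun (x : S) => x.1) (V := D2 q A) hP0 hP2 hrq hr2
        (fun x => by simpa using sum_rpow_le_of_lpNorm_le hrt hr0 (hSU x.2).1) hb0
        (fun x i => Real.rpow_le_rpow (abs_nonneg _) ((hSU x.2).2 i) (by linarith)) hD0
        (fun i j => (abs_le_lpNorm hps0 (fun j => A i j) j).trans (hD i))
        (fun i δ τ hδ hτ hs => sum_sq_mul_sq_le hp hps (hD i) hδ hτ hs) hV
        (L := L) (Λ := 4 * L) (by linarith)
        (by rw [Fintype.card_fin]; exact le_max_right _ _) (by linarith)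
        (by rw [Fintype.card_fin]; exact log_mul_le hn))
  simp only [Set.mem_ofPred_eq, and_assoc] at key
  refine key.trans ?_
  have hK4 : (K : ℝ) + 1 ≤ 4 * L := log_two_add_one_le n
  have hsL : 0 ≤ √L := Real.sqrt_nonneg L
  have hL32 : L ^ ((3 : ℝ) / 2) = L * √L := by
    rw [show (3 : ℝ) / 2 = 1 + 1 / 2 by norm_num, Real.rpow_add (by linarith), Real.rpow_one,
      Real.sqrt_eq_rpow]
  have h48 : √(12 * (4 * L)) ≤ 7 * √L := by
    rw [show (7 : ℝ) * √L = √(7 ^ 2 * L) by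
      rw [Real.sqrt_mul (by norm_num), Real.sqrt_sq (by norm_num)]]
    exact Real.sqrt_le_sqrt (by linarith)
  have hbD : 0 ≤ a ^ ((2 - qstar.toReal) / 2) * D1 pstar A := mul_nonneg hb0 hD0
  rw [hL32]
  set b := a ^ ((2 - qstar.toReal) / 2)
  set X := √q.toReal * D2 q A
  have hX : 0 ≤ X := mul_nonneg (Real.sqrt_nonneg _) hV0
  have hsLL : √L ≤ L * √L := le_mul_of_one_le_left hsL hL1
  have h1 : ((K : ℝ) + 1) * (2 * √(12 * (4 * L))) ≤ 56 * (L * √L) := by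
    calc ((K : ℝ) + 1) * (2 * √(12 * (4 * L))) ≤ 4 * L * (2 * (7 * √L)) := by gcongr
      _ = _ := by ring
  calc 2 * (3 * (Real.exp 2 * √q.toReal * D2 q A + 2 * (b * D1 pstar A) * √L)
        + b * ((K + 1) * (D1 pstar A * (2 * √(12 * (4 * L))))))
      = 6 * Real.exp 2 * X + b * D1 pstar A * (12 * √L
        + 2 * (((K : ℝ) + 1) * (2 * √(12 * (4 * L))))) := by ring
    _ ≤ 6 * Real.exp 2 * X + b * D1 pstar A * (124 * (L * √L)) := by
        gcongr
        linarith
    _ ≤ (6 * Real.exp 2 + 124) * (X + b * D1 pstar A * (L * √L)) := by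
        have : 0 ≤ b * D1 pstar A * (L * √L) := by positivity
        nlinarith [mul_nonneg (Real.exp_pos 2).le this]
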